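/- (Homogeneous multilinear recursion.) Let x = (x_1,...,x_n) be i.i.d. real random variables with E[x_i] = 0, E[x_i²] = 1 and |x_i| ≤ L almost surely. Let {A_i}_{i ∈ T^d_n} be deterministic real matrices of a common dimension that are permutation symmetric (A_{i_1,...,i_d} = A_{i_{σ(1)},...,i_{σ(d)}} for every permutation σ of [d]), and define the degree-d homogeneous multilinear polynomial random matrix F(x) = Σ_{i ∈ T^d_n} A_i · x_{i_1} ⋯ x_{i_d}. Then for every 2 ≤ t < ∞, E ‖F(x) − E F(x)‖_{4t}^{4t} ≤ Σ_{a+b+c=d, a,b,c ≥ 0} (48dt)^{4dt} · L^{4ct} · ‖F_{a,b,c}‖_{4t}^{4t}, where the matrices F_{a,b,c} with a+b+c = d are deterministic. -/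

import Mathlib

open MeasureTheory ProbabilityTheory Matrix
open scoped BigOperators ENNReal

/-- Entrywise expectation of a random matrix. -/
noncomputable def matIntegral {Ω : Type*} [MeasurableSpace Ω] (μ : Measure Ω)
    {R C : Type*} (M : Ω → Matrix R C ℝ) : Matrix R C ℝ :=
  Matrix.of fun i j => ∫ ω, M ω i j ∂μ

/-- `schattenPow t A = tr ((AᴴA)^t) = ‖A‖_{2t}^{2t}`, the `2t`-th power of the Schatten
`2t`-norm of a real matrix `A`, defined for a real exponent `t` via the eigenvalues of
the Hermitian matrix `AᴴA`. -/
noncomputable def schattenPow {R C : Type*} [Fintype R] [Fintype C] [DecidableEq C]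
    (t : ℝ) (A : Matrix R C ℝ) : ℝ :=
  ∑ i, (Matrix.isHermitian_conjTranspose_mul_self A).eigenvalues i ^ t

/-- The Schatten `2t`-norm of a real matrix: `‖A‖_{2t} = (tr ((AᴴA)^t))^(1/(2t))`. -/
noncomputable def schattenNorm {R C : Type*} [Fintype R] [Fintype C] [DecidableEq C]
    (t : ℝ) (A : Matrix R C ℝ) : ℝ :=
  schattenPow t A ^ (2 * t)⁻¹
/-- Entrywise partial derivative of a matrix-valued function with respect to the
coordinate `v`. -/
noncomputable def pderivAt {ι : Type*} [Fintype ι] [DecidableEq ι] {R C : Type*}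
    (F : (ι → ℝ) → Matrix R C ℝ) (v : ι) : (ι → ℝ) → Matrix R C ℝ :=
  fun x => Matrix.of fun r c => fderiv ℝ (fun y => F y r c) x (Pi.single v 1)

/-- Iterated entrywise partial derivative along a tuple of coordinates. -/
noncomputable def iterPDeriv {ι : Type*} [Fintype ι] [DecidableEq ι] {R C : Type*}
    (F : (ι → ℝ) → Matrix R C ℝ) : {k : ℕ} → (Fin k → ι) → (ι → ℝ) → Matrix R C ℝ
  | 0, _ => F
  | _ + 1, w => pderivAt (iterPDeriv F fun j => w j.castSucc) (w (Fin.last _))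

/-- The partial-derivative block matrix `F_{a,b,c}`: rows carry the `a` vertically stacked
derivative directions, columns the `b` horizontally placed ones, and the `c` block-diagonal
directions appear in both (with the diagonal constraint). -/
noncomputable def derivBlocks {n : ℕ} {R C : Type*}
    (F : (Fin n → ℝ) → Matrix R C ℝ) (a b c : ℕ) :
    (Fin n → ℝ) →
      Matrix ((Fin a → Fin n) × (Fin c → Fin n) × R) ((Fin b → Fin n) × (Fin c → Fin n) × C) ℝ :=
  fun x => Matrix.of fun p q =>
    if p.2.1 = q.2.1 then
      iterPDeriv F (Fin.append (Fin.append p.1 q.1) p.2.1) x p.2.2 q.2.2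
    else 0

/-- The partial-derivative block matrix `F_{a,b}` (no diagonal blocks): rows carry the `a`
vertically stacked derivative directions and columns the `b` horizontally placed ones. -/
noncomputable def derivBlocks2 {ι : Type*} [Fintype ι] [DecidableEq ι] {R C : Type*}
    (F : (ι → ℝ) → Matrix R C ℝ) (a b : ℕ) :
    (ι → ℝ) → Matrix ((Fin a → ι) × R) ((Fin b → ι) × C) ℝ :=
  fun x => Matrix.of fun p q => iterPDeriv F (Fin.append p.1 q.1) x p.2 q.2


/-! ### scalar inequalities -/

lemma hmr_pow_sub {m a b : ℝ} (hm : 1 ≤ m) (hb : 0 ≤ b) (hab : b ≤ a) :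
    a ^ m - b ^ m ≤ m * a ^ (m - 1) * (a - b) := by
  rcases eq_or_lt_of_le (hb.trans hab) with h | h
  · subst h
    have : b = 0 := le_antisymm hab hb
    subst this; simp
  · have h1 := one_add_mul_self_le_rpow_one_add (s := b / a - 1) (p := m)
      (by have := div_nonneg hb h.le; linarith) hm
    have h2 : (1 + (b / a - 1)) ^ m = b ^ m / a ^ m := by
      rw [← Real.div_rpow hb h.le]; ring_nf
    rw [h2] at h1
    have h3 : a ^ m = a ^ (m - 1) * a := by
      rw [← Real.rpow_add_one h.ne']; ring_nf
    have hp : 0 < a ^ m := Real.rpow_pos_of_pos h m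
    have h4 : (1 + m * (b / a - 1)) * a ^ m ≤ b ^ m := by
      rwa [le_div_iff₀ hp] at h1
    have h5 : (1 + m * (b / a - 1)) * a ^ m = a ^ m + m * a ^ (m - 1) * (b - a) := by
      rw [h3]; field_simp
    nlinarith

lemma hmr_abs_pow_sub {m : ℝ} (hm : 1 ≤ m) (x y : ℝ) :
    |(|x| ^ m - |y| ^ m)| ≤ m * (max |x| |y|) ^ (m - 1) * |x - y| := by
  wlog h : |y| ≤ |x| generalizing x y
  · have := this y x (le_of_not_ge h)
    rwa [abs_sub_comm, max_comm, abs_sub_comm x y]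
  · rw [max_eq_left h, abs_of_nonneg (sub_nonneg.2 (Real.rpow_le_rpow (abs_nonneg _) h (by linarith)))]
    refine (hmr_pow_sub hm (abs_nonneg _) h).trans ?_
    gcongr
    exact abs_sub_abs_le_abs_sub x y

lemma hmr_max_le {r : ℝ} (x y : ℝ) : (max |x| |y|) ^ r ≤ |x| ^ r + |y| ^ r := by
  rcases max_cases |x| |y| with h | h <;> rw [h.1] <;>
  have h1 := Real.rpow_nonneg (abs_nonneg x) r <;>
  have h2 := Real.rpow_nonneg (abs_nonneg y) r <;> linarith

lemma hmr_g_lip {m : ℝ} (hm : 1 ≤ m) (x y : ℝ) :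
    |(|x| ^ m - |y| ^ m)| ≤ m * (|x| ^ (m - 1) + |y| ^ (m - 1)) * |x - y| := by
  refine (hmr_abs_pow_sub hm x y).trans ?_
  gcongr
  exact hmr_max_le x y

lemma hmr_f_lip {m : ℝ} (hm : 1 ≤ m) (x y : ℝ) :
    |(x * |x| ^ m - y * |y| ^ m)| ≤ (m + 1) * (|x| ^ m + |y| ^ m) * |x - y| := by
  have e : x * |x| ^ m - y * |y| ^ m = (x - y) * |x| ^ m + y * (|x| ^ m - |y| ^ m) := by ring
  have h0 : 0 ≤ max |x| |y| := (abs_nonneg x).trans (le_max_left _ _)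
  have h1 : |y| * (m * (max |x| |y|) ^ (m - 1)) ≤ m * (|x| ^ m + |y| ^ m) := by
    calc |y| * (m * (max |x| |y|) ^ (m - 1)) ≤ max |x| |y| * (m * (max |x| |y|) ^ (m - 1)) := by
          gcongr; exact le_max_right _ _
      _ = m * (max |x| |y|) ^ m := by
          rcases eq_or_lt_of_le h0 with h | h
          · rw [← h, Real.zero_rpow (show m ≠ 0 by linarith)]; ring
          · have : (max |x| |y|) ^ m = (max |x| |y|) ^ (m - 1) * (max |x| |y|) := by
              rw [← Real.rpow_add_one h.ne']; ring_nf
            rw [this]; ring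
      _ ≤ _ := by gcongr; exact hmr_max_le x y
  have h2 := hmr_abs_pow_sub hm x y
  have hy := Real.rpow_nonneg (abs_nonneg y) m
  have hx := Real.rpow_nonneg (abs_nonneg x) m
  rw [e]
  calc _ ≤ |x - y| * |x| ^ m + |y| * |(|x| ^ m - |y| ^ m)| := by
        refine (abs_add_le _ _).trans ?_
        rw [abs_mul, abs_mul, abs_of_nonneg hx]
    _ ≤ |x - y| * |x| ^ m + |y| * (m * (max |x| |y|) ^ (m - 1) * |x - y|) := by gcongr
    _ = |x - y| * |x| ^ m + (|y| * (m * (max |x| |y|) ^ (m - 1))) * |x - y| := by ring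
    _ ≤ |x - y| * |x| ^ m + (m * (|x| ^ m + |y| ^ m)) * |x - y| := by gcongr
    _ ≤ _ := by nlinarith [abs_nonneg (x - y), mul_nonneg (abs_nonneg (x - y)) hy]

lemma hmr_young4 {m h η : ℝ} (hm : 2 < m) (hh : 0 ≤ h) (hη : 0 < η) (a l : ℝ) :
    h ^ 2 / η * (a ^ 4 * |l| ^ (m - 2)) ≤
      η * (a ^ 2 * |l| ^ m) + η * (h / η) ^ m * |a| ^ (m + 2) := by
  have n1 : 0 ≤ η * (a ^ 2 * |l| ^ m) := by positivity
  have n2 : 0 ≤ η * (h / η) ^ m * |a| ^ (m + 2) := by positivity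
  have key : ∀ x : ℝ, 0 ≤ x → x ^ m = x ^ (m - 2) * x ^ 2 := by
    intro x hx
    rw [← Real.rpow_natCast x 2, ← Real.rpow_add' hx (by norm_num; linarith)]; norm_num
  rcases le_total (h * |a|) (η * |l|) with c | c
  · refine le_trans ?_ (le_add_of_nonneg_right n2)
    rw [key _ (abs_nonneg l)]
    have : (h * |a|) ^ 2 ≤ (η * |l|) ^ 2 := by gcongr
    have e1 : h ^ 2 / η * (a ^ 4 * |l| ^ (m - 2)) = (h * |a|) ^ 2 * (a ^ 2 * |l| ^ (m - 2) / η) := by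
      rw [mul_pow, sq_abs]; ring
    have e2 : η * (a ^ 2 * (|l| ^ (m - 2) * |l| ^ 2)) = (η * |l|) ^ 2 * (a ^ 2 * |l| ^ (m - 2) / η) := by
      field_simp
    rw [e1, e2]
    gcongr
  · refine le_trans ?_ (le_add_of_nonneg_left n1)
    have c' : |l| ≤ h / η * |a| := by
      rw [div_mul_eq_mul_div, le_div_iff₀ hη]; linarith
    have e3 : |a| ^ (m + 2) = |a| ^ m * a ^ 2 := by
      rw [← sq_abs a, ← Real.rpow_natCast |a| 2, ← Real.rpow_add' (abs_nonneg a) (by norm_num; linarith)]; norm_num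
    calc h ^ 2 / η * (a ^ 4 * |l| ^ (m - 2)) ≤ h ^ 2 / η * (a ^ 4 * (h / η * |a|) ^ (m - 2)) := by
          gcongr
      _ = η * a ^ 2 * ((h / η * |a|) ^ (m - 2) * (h / η * |a|) ^ 2) := by
          rw [mul_pow _ _ 2, sq_abs]; field_simp
      _ = η * a ^ 2 * (h / η * |a|) ^ m := by rw [← key _ (by positivity)]
      _ = _ := by rw [e3, Real.mul_rpow (by positivity) (abs_nonneg a)]; ring

lemma hmr_young2 {m θ : ℝ} (hm : 0 < m) (hθ : 0 < θ) (v l : ℝ) (hv : 0 ≤ v) :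
    v * |l| ^ m ≤ θ * |l| ^ (m + 2) + θ⁻¹ ^ (m / 2) * v ^ ((m + 2) / 2) := by
  have n1 : 0 ≤ θ * |l| ^ (m + 2) := by positivity
  have n2 : 0 ≤ θ⁻¹ ^ (m / 2) * v ^ ((m + 2) / 2) := by positivity
  rcases le_total v (θ * |l| ^ 2) with c | c
  · refine le_trans ?_ (le_add_of_nonneg_right n2)
    have e3 : |l| ^ (m + 2) = |l| ^ m * |l| ^ 2 := by
      rw [← Real.rpow_natCast |l| 2, ← Real.rpow_add' (abs_nonneg l) (by norm_num; linarith)]; norm_num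
    calc v * |l| ^ m ≤ (θ * |l| ^ 2) * |l| ^ m := by gcongr
      _ = _ := by rw [e3]; ring
  · refine le_trans ?_ (le_add_of_nonneg_left n1)
    have c' : |l| ^ 2 ≤ θ⁻¹ * v := by
      rw [inv_mul_eq_div, le_div_iff₀ hθ]; linarith
    have e : |l| ^ m = (|l| ^ 2) ^ (m / 2) := by
      rw [← Real.rpow_natCast |l| 2, ← Real.rpow_mul (abs_nonneg l)]; congr 1; push_cast; ring
    calc v * |l| ^ m ≤ v * (θ⁻¹ * v) ^ (m / 2) := by rw [e]; gcongr
      _ = θ⁻¹ ^ (m / 2) * (v ^ (m / 2) * v ^ (1:ℝ)) := by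
          rw [Real.mul_rpow (by positivity) hv, Real.rpow_one]; ring
      _ = _ := by
          rw [← Real.rpow_add' hv (by positivity)]; congr 2; ring

/-! ### spectral calculus -/

section spectral
variable {N : Type*} [Fintype N] [DecidableEq N]

lemma hmr_exists_diag (M : Matrix N N ℝ) (hM : M.IsHermitian) :
    ∃ (U : Matrix N N ℝ) (l : N → ℝ), U * Uᵀ = 1 ∧ Uᵀ * U = 1 ∧ M = U * diagonal l * Uᵀ ∧
      (l = hM.eigenvalues) ∧
      ∀ g : ℝ → ℝ, cfc g M = U * diagonal (fun i => g (l i)) * Uᵀ := by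
  have h1 : (hM.eigenvectorUnitary : Matrix N N ℝ) * (hM.eigenvectorUnitary : Matrix N N ℝ)ᵀ = 1 := by
    have := Unitary.coe_mul_star_self hM.eigenvectorUnitary
    simpa [star_eq_conjTranspose] using this
  have h2 : (hM.eigenvectorUnitary : Matrix N N ℝ)ᵀ * (hM.eigenvectorUnitary : Matrix N N ℝ) = 1 := by
    have := Unitary.coe_star_mul_self hM.eigenvectorUnitary
    simpa [star_eq_conjTranspose] using this
  refine ⟨hM.eigenvectorUnitary, hM.eigenvalues, h1, h2, ?_, rfl, ?_⟩
  · have := hM.spectral_theorem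
    rw [Unitary.conjStarAlgAut_apply] at this
    simpa [star_eq_conjTranspose, Function.comp_def] using this
  · intro g
    rw [hM.cfc_eq, Matrix.IsHermitian.cfc, Unitary.conjStarAlgAut_apply]
    simp [star_eq_conjTranspose, Function.comp_def]

lemma hmr_tr_diag (U K : Matrix N N ℝ) (l : N → ℝ) :
    trace (K * (U * diagonal l * Uᵀ)) = ∑ i, l i * (Uᵀ * K * U) i i := by
  have : trace (K * (U * diagonal l * Uᵀ)) = trace ((Uᵀ * K * U) * diagonal l) := by
    rw [← Matrix.mul_assoc, Matrix.trace_mul_comm]; simp only [Matrix.mul_assoc]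
  rw [this, trace]
  refine Finset.sum_congr rfl fun i _ => ?_
  rw [diag_apply, mul_diagonal, mul_comm]

lemma hmr_tr_two (U V : Matrix N N ℝ) (l k : N → ℝ) :
    trace ((V * diagonal k * Vᵀ) * (U * diagonal l * Uᵀ)) =
      ∑ i, ∑ j, (Uᵀ * V) i j ^ 2 * (k j * l i) := by
  rw [hmr_tr_diag]
  refine Finset.sum_congr rfl fun i _ => ?_
  have : Uᵀ * (V * diagonal k * Vᵀ) * U = (Uᵀ * V) * diagonal k * (Uᵀ * V)ᵀ := by
    simp only [Matrix.mul_assoc, transpose_mul, transpose_transpose]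
  rw [this, mul_apply, Finset.mul_sum]
  refine Finset.sum_congr rfl fun j _ => ?_
  rw [mul_diagonal, transpose_apply]; ring

lemma hmr_tr_diff (U V K : Matrix N N ℝ) (hU : U * Uᵀ = 1) (hV : V * Vᵀ = 1) (l k : N → ℝ) :
    trace (K * (U * diagonal l * Uᵀ - V * diagonal k * Vᵀ)) =
      ∑ i, ∑ j, (l i - k j) * (Uᵀ * V) i j * (Vᵀ * K * U) j i := by
  have e1 : trace (K * (U * diagonal l * Uᵀ)) =
      ∑ i, ∑ j, l i * (Uᵀ * V) i j * (Vᵀ * K * U) j i := by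
    rw [hmr_tr_diag]
    refine Finset.sum_congr rfl fun i _ => ?_
    have : Uᵀ * K * U = (Uᵀ * V) * (Vᵀ * K * U) := by
      calc Uᵀ * K * U = Uᵀ * 1 * K * U := by simp
        _ = _ := by rw [← hV]; simp only [Matrix.mul_assoc]
    rw [this, mul_apply, Finset.mul_sum]
    refine Finset.sum_congr rfl fun j _ => by ring
  have e2 : trace (K * (V * diagonal k * Vᵀ)) =
      ∑ i, ∑ j, k j * (Uᵀ * V) i j * (Vᵀ * K * U) j i := by
    rw [hmr_tr_diag, Finset.sum_comm]
    refine Finset.sum_congr rfl fun j _ => ?_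
    have : Vᵀ * K * V = (Vᵀ * K * U) * (Uᵀ * V) := by
      calc Vᵀ * K * V = Vᵀ * K * 1 * V := by simp
        _ = _ := by rw [← hU]; simp only [Matrix.mul_assoc]
    rw [this, mul_apply, Finset.mul_sum]
    refine Finset.sum_congr rfl fun i _ => by ring
  rw [Matrix.mul_sub, trace_sub, e1, e2, ← Finset.sum_sub_distrib]
  refine Finset.sum_congr rfl fun i _ => ?_
  rw [← Finset.sum_sub_distrib]
  refine Finset.sum_congr rfl fun j _ => by ring

lemma hmr_conj_sub (U V : Matrix N N ℝ) (hU : Uᵀ * U = 1) (hV : Vᵀ * V = 1) (l k : N → ℝ) (i j : N) :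
    (Uᵀ * (U * diagonal l * Uᵀ - V * diagonal k * Vᵀ) * V) i j = (l i - k j) * (Uᵀ * V) i j := by
  have : Uᵀ * (U * diagonal l * Uᵀ - V * diagonal k * Vᵀ) * V =
      diagonal l * (Uᵀ * V) - (Uᵀ * V) * diagonal k := by
    calc _ = (Uᵀ * U) * diagonal l * (Uᵀ * V) - (Uᵀ * V) * diagonal k * (Vᵀ * V) := by
          simp only [Matrix.mul_sub, Matrix.sub_mul, Matrix.mul_assoc]
      _ = _ := by rw [hU, hV]; simp
  rw [this, Matrix.sub_apply, diagonal_mul, mul_diagonal]; ring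

lemma hmr_rowsq (U V K : Matrix N N ℝ) (hV : V * Vᵀ = 1) (hK : Kᵀ = K) (i : N) :
    ∑ j, (Uᵀ * K * V) i j ^ 2 = (Uᵀ * (K * K) * U) i i := by
  have : Uᵀ * (K * K) * U = (Uᵀ * K * V) * (Uᵀ * K * V)ᵀ := by
    simp only [transpose_mul, transpose_transpose, hK]
    calc _ = Uᵀ * K * 1 * K * U := by simp only [Matrix.mul_assoc, Matrix.one_mul]
      _ = _ := by rw [← hV]; simp only [Matrix.mul_assoc]
  rw [this, mul_apply]
  refine Finset.sum_congr rfl fun j _ => ?_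
  rw [transpose_apply]; ring

lemma hmr_swap (U V K : Matrix N N ℝ) (hK : Kᵀ = K) (i j : N) :
    (Vᵀ * K * U) j i = (Uᵀ * K * V) i j := by
  rw [← transpose_apply (Vᵀ * K * U)]
  simp only [transpose_mul, transpose_transpose, hK, Matrix.mul_assoc]

/-- first mean value trace inequality -/
lemma hmr_P1 {m : ℝ} (hm : 1 ≤ m) (A B D : Matrix N N ℝ) (hA : A.IsHermitian) (hB : B.IsHermitian)
    (hD : D.IsHermitian) (s : ℝ) (hs : A = B + s • D) :
    s * trace (D * cfc (fun x : ℝ => x * |x| ^ m) A) ≤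
      s * trace (D * cfc (fun x : ℝ => x * |x| ^ m) B) +
      s ^ 2 * ((m + 1) * (trace (D * D * cfc (fun x : ℝ => |x| ^ m) A) +
        trace (D * D * cfc (fun x : ℝ => |x| ^ m) B))) := by
  have hDt : Dᵀ = D := by simpa using hD.eq
  obtain ⟨U, l, hU1, hU2, hAe, -, hAg⟩ := hmr_exists_diag A hA
  obtain ⟨V, k, hV1, hV2, hBe, -, hBg⟩ := hmr_exists_diag B hB
  have hd : ∀ i j, s * (Uᵀ * D * V) i j = (l i - k j) * (Uᵀ * V) i j := by
    intro i j
    rw [← hmr_conj_sub U V hU2 hV2, ← hAe, ← hBe, hs]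
    simp
  have key : s * trace (D * (cfc (fun x : ℝ => x * |x| ^ m) A - cfc (fun x : ℝ => x * |x| ^ m) B)) ≤
      s ^ 2 * ((m + 1) * (trace (D * D * cfc (fun x : ℝ => |x| ^ m) A) +
        trace (D * D * cfc (fun x : ℝ => |x| ^ m) B))) := by
    rw [hAg, hBg, hAg, hBg, hmr_tr_diff U V D hU1 hV1, hmr_tr_diag, hmr_tr_diag]
    have r1 : ∀ i, (Uᵀ * (D * D) * U) i i = ∑ j, (Uᵀ * D * V) i j ^ 2 :=
      fun i => (hmr_rowsq U V D hV1 hDt i).symm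
    have r2 : ∀ j, (Vᵀ * (D * D) * V) j j = ∑ i, (Uᵀ * D * V) i j ^ 2 := by
      intro j
      rw [← hmr_rowsq V U D hU1 hDt j]
      exact Finset.sum_congr rfl fun i _ => by rw [hmr_swap U V D hDt]
    simp only [r1, r2, Finset.mul_sum]
    rw [Finset.sum_comm (γ := N) (f := fun x y => |k x| ^ m * (Uᵀ * D * V) y x ^ 2)]
    simp only [← Finset.sum_add_distrib, Finset.mul_sum]
    refine Finset.sum_le_sum fun i _ => Finset.sum_le_sum fun j _ => ?_
    rw [hmr_swap U V D hDt]
    have h1 := hmr_f_lip hm (l i) (k j)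
    have h2 := hd i j
    set d := (Uᵀ * D * V) i j
    set w := (Uᵀ * V) i j
    set F := l i * |l i| ^ m - k j * |k j| ^ m
    calc s * (F * w * d) = F * (w * (s * d)) := by ring
      _ ≤ |F| * |w * (s * d)| := by rw [← abs_mul]; exact le_abs_self _
      _ ≤ ((m + 1) * (|l i| ^ m + |k j| ^ m) * |l i - k j|) * |w * (s * d)| := by gcongr
      _ = (m + 1) * (|l i| ^ m + |k j| ^ m) * |((l i - k j) * w) * (s * d)| := by
          simp only [abs_mul]; ring
      _ = (m + 1) * (|l i| ^ m + |k j| ^ m) * (s * d) ^ 2 := by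
          rw [← h2, ← sq, abs_of_nonneg (sq_nonneg (s * d))]
      _ = _ := by ring
  rw [Matrix.mul_sub, trace_sub, mul_sub] at key
  linarith

lemma hmr_P2half {m h η : ℝ} (hm : 2 < m) (hh : 0 ≤ h) (hη : 0 < η)
    (A D U V : Matrix N N ℝ) (l : N → ℝ) (hV1 : V * Vᵀ = 1)
    (hAg : ∀ g : ℝ → ℝ, cfc g A = U * diagonal (fun i => g (l i)) * Uᵀ)
    (hD : D.IsHermitian) (hU1 : U * Uᵀ = 1) :
    ∑ i, ∑ j, h * |l i| ^ (m - 1) * |(Uᵀ * D * V) i j| * |(Uᵀ * (D * D) * V) i j| ≤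
      η * trace (D * D * cfc (fun x : ℝ => |x| ^ m) A) +
        η / 2 * (h / η) ^ m * trace (cfc (fun x : ℝ => |x| ^ (m + 2)) D) := by
  have hDt : Dᵀ = D := by simpa using hD.eq
  have hDDt : (D * D)ᵀ = D * D := by rw [transpose_mul, hDt]
  obtain ⟨W, a, hW1, hW2, hDe, -, hDg⟩ := hmr_exists_diag D hD
  have D2 : D * D = W * diagonal (fun i => a i ^ 2) * Wᵀ := by
    conv_lhs => rw [hDe]
    calc _ = W * (diagonal a * (Wᵀ * W) * diagonal a) * Wᵀ := by simp only [Matrix.mul_assoc]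
      _ = _ := by rw [hW2, Matrix.mul_one, diagonal_mul_diagonal]; simp only [sq]
  have D4 : (D * D) * (D * D) = W * diagonal (fun i => a i ^ 4) * Wᵀ := by
    rw [D2]
    calc _ = W * (diagonal (fun i => a i ^ 2) * (Wᵀ * W) * diagonal (fun i => a i ^ 2)) * Wᵀ := by
          simp only [Matrix.mul_assoc]
      _ = _ := by
          rw [hW2, Matrix.mul_one, diagonal_mul_diagonal]; congr; ext; ring
  have tp : trace (cfc (fun x : ℝ => |x| ^ (m + 2)) D) =
      ∑ i, ∑ j, (Uᵀ * W) i j ^ 2 * (|a j| ^ (m + 2)) := by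
    have := hmr_tr_two U W (fun _ => 1) (fun j => |a j| ^ (m + 2))
    rw [diagonal_one, Matrix.mul_one, hU1, Matrix.mul_one, ← hDg (fun x => |x| ^ (m + 2))] at this
    rw [this]; simp only [mul_one]
  have t2 : trace (D * D * cfc (fun x : ℝ => |x| ^ m) A) =
      ∑ i, ∑ j, (Uᵀ * W) i j ^ 2 * (a j ^ 2 * |l i| ^ m) := by
    rw [D2, hAg, hmr_tr_two]
  have t2' : trace (D * D * cfc (fun x : ℝ => |x| ^ m) A) =
      ∑ i, ∑ j, |l i| ^ m * (Uᵀ * D * V) i j ^ 2 := by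
    rw [hAg, hmr_tr_diag]
    exact Finset.sum_congr rfl fun i _ => by rw [← hmr_rowsq U V D hV1 hDt, Finset.mul_sum]
  have t4 : ∑ i, ∑ j, |l i| ^ (m - 2) * (Uᵀ * (D * D) * V) i j ^ 2 =
      ∑ i, ∑ j, (Uᵀ * W) i j ^ 2 * (a j ^ 4 * |l i| ^ (m - 2)) := by
    rw [← hmr_tr_two, ← D4, hmr_tr_diag]
    exact Finset.sum_congr rfl fun i _ => by rw [← hmr_rowsq U V (D * D) hV1 hDDt, Finset.mul_sum]
  have s1 : ∑ i, ∑ j, h * |l i| ^ (m - 1) * |(Uᵀ * D * V) i j| * |(Uᵀ * (D * D) * V) i j| ≤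
      η / 2 * ∑ i, ∑ j, |l i| ^ m * (Uᵀ * D * V) i j ^ 2 +
      1 / 2 * (h ^ 2 / η * ∑ i, ∑ j, |l i| ^ (m - 2) * (Uᵀ * (D * D) * V) i j ^ 2) := by
    simp only [Finset.mul_sum, ← Finset.sum_add_distrib]
    refine Finset.sum_le_sum fun i _ => Finset.sum_le_sum fun j _ => ?_
    set d := (Uᵀ * D * V) i j
    set e := (Uᵀ * (D * D) * V) i j
    have k1 : |l i| ^ m = |l i| ^ (m - 2) * |l i| ^ 2 := by
      rw [← Real.rpow_natCast _ 2, ← Real.rpow_add' (abs_nonneg _) (by norm_num; linarith)]; norm_num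
    have k2 : |l i| ^ (m - 1) = |l i| ^ (m - 2) * |l i| := by
      rw [← Real.rpow_add_one' (abs_nonneg _) (by linarith)]; congr 1; ring
    rw [k1, k2, ← sq_abs d, ← sq_abs e]
    have n : 0 ≤ |l i| ^ (m - 2) := by positivity
    have q := sq_nonneg (η * |l i| * |d| - h * |e|)
    have : h * |l i| * |d| * |e| ≤ η / 2 * (|l i| ^ 2 * |d| ^ 2) + 1 / 2 * (h ^ 2 / η * |e| ^ 2) := by
      have : η / 2 * (|l i| ^ 2 * |d| ^ 2) + 1 / 2 * (h ^ 2 / η * |e| ^ 2) - h * |l i| * |d| * |e| =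
        (η * |l i| * |d| - h * |e|) ^ 2 / (2 * η) := by field_simp; ring
      have : 0 ≤ (η * |l i| * |d| - h * |e|) ^ 2 / (2 * η) := by positivity
      linarith
    nlinarith [mul_le_mul_of_nonneg_left this n]
  have s2 : h ^ 2 / η * ∑ i, ∑ j, |l i| ^ (m - 2) * (Uᵀ * (D * D) * V) i j ^ 2 ≤
      η * trace (D * D * cfc (fun x : ℝ => |x| ^ m) A) +
        η * (h / η) ^ m * trace (cfc (fun x : ℝ => |x| ^ (m + 2)) D) := by
    rw [t4, tp, t2]
    simp only [Finset.mul_sum, ← Finset.sum_add_distrib]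
    refine Finset.sum_le_sum fun i _ => Finset.sum_le_sum fun j _ => ?_
    have := mul_le_mul_of_nonneg_left (hmr_young4 hm hh hη (a j) (l i)) (sq_nonneg ((Uᵀ * W) i j))
    nlinarith [this]
  rw [← t2'] at s1
  linarith

/-- second mean value trace inequality -/
lemma hmr_P2 {m : ℝ} (hm : 2 < m) (A B D : Matrix N N ℝ) (hA : A.IsHermitian) (hB : B.IsHermitian)
    (hD : D.IsHermitian) (s : ℝ) (hs : A = B + s • D) :
    trace (D * D * cfc (fun x : ℝ => |x| ^ m) A) ≤
      2 * trace (D * D * cfc (fun x : ℝ => |x| ^ m) B) +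
      1 / 2 * (3 * m * |s|) ^ m * trace (cfc (fun x : ℝ => |x| ^ (m + 2)) D) := by
  have hDt : Dᵀ = D := by simpa using hD.eq
  have hDDt : (D * D)ᵀ = D * D := by rw [transpose_mul, hDt]
  obtain ⟨U, l, hU1, hU2, hAe, -, hAg⟩ := hmr_exists_diag A hA
  obtain ⟨V, k, hV1, hV2, hBe, -, hBg⟩ := hmr_exists_diag B hB
  have hd : ∀ i j, s * (Uᵀ * D * V) i j = (l i - k j) * (Uᵀ * V) i j := by
    intro i j
    rw [← hmr_conj_sub U V hU2 hV2, ← hAe, ← hBe, hs]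
    simp
  have hm0 : 0 < m := by linarith
  have a1 := hmr_P2half (η := 1 / (3 * m)) hm (abs_nonneg s) (by positivity) A D U V l hV1 hAg hD hU1
  have a2 := hmr_P2half (η := 1 / (3 * m)) hm (abs_nonneg s) (by positivity) B D V U k hU1 hBg hD hV1
  have key : trace (D * D * (cfc (fun x : ℝ => |x| ^ m) A - cfc (fun x : ℝ => |x| ^ m) B)) ≤
      m * (∑ i, ∑ j, |s| * |l i| ^ (m - 1) * |(Uᵀ * D * V) i j| * |(Uᵀ * (D * D) * V) i j| +
      ∑ i, ∑ j, |s| * |k i| ^ (m - 1) * |(Vᵀ * D * U) i j| * |(Vᵀ * (D * D) * U) i j|) := by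
    rw [hAg, hBg, hmr_tr_diff U V (D * D) hU1 hV1]
    rw [Finset.sum_comm (f := fun i j => |s| * |k i| ^ (m - 1) * |(Vᵀ * D * U) i j| * |(Vᵀ * (D * D) * U) i j|)]
    simp only [Finset.mul_sum, ← Finset.sum_add_distrib]
    refine Finset.sum_le_sum fun i _ => Finset.sum_le_sum fun j _ => ?_
    rw [hmr_swap U V D hDt, hmr_swap U V (D * D) hDDt]
    have h1 := hmr_g_lip (by linarith : 1 ≤ m) (l i) (k j)
    have h2 := hd i j
    set d := (Uᵀ * D * V) i j
    set e := (Uᵀ * (D * D) * V) i j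
    set w := (Uᵀ * V) i j
    set F := |l i| ^ m - |k j| ^ m
    calc F * w * e ≤ |F| * (|w| * |e|) := by
          rw [← abs_mul, ← abs_mul, ← mul_assoc]; exact le_abs_self _
      _ ≤ (m * (|l i| ^ (m - 1) + |k j| ^ (m - 1)) * |l i - k j|) * (|w| * |e|) := by gcongr
      _ = m * (|l i| ^ (m - 1) + |k j| ^ (m - 1)) * |(l i - k j) * w| * |e| := by
          rw [abs_mul]; ring
      _ = m * (|l i| ^ (m - 1) + |k j| ^ (m - 1)) * (|s| * |d|) * |e| := by
          rw [← h2, abs_mul]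
      _ = _ := by ring
  have e0 : |s| / (1 / (3 * m)) = 3 * m * |s| := by field_simp
  rw [e0] at a1 a2
  rw [Matrix.mul_sub, trace_sub] at key
  have e1 : m * (1 / (3 * m)) = 1 / 3 := by field_simp
  have e2 : m * (1 / (3 * m) / 2) = 1 / 6 := by field_simp; norm_num
  have b := mul_le_mul_of_nonneg_left (add_le_add a1 a2) hm0.le
  set TA := trace (D * D * cfc (fun x : ℝ => |x| ^ m) A)
  set TB := trace (D * D * cfc (fun x : ℝ => |x| ^ m) B)
  set T := trace (cfc (fun x : ℝ => |x| ^ (m + 2)) D)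
  have e3 : m * (1 / (3 * m) * TA + 1 / (3 * m) / 2 * (3 * m * |s|) ^ m * T +
      (1 / (3 * m) * TB + 1 / (3 * m) / 2 * (3 * m * |s|) ^ m * T)) =
      1 / 3 * (TA + TB) + 1 / 3 * ((3 * m * |s|) ^ m * T) := by
    linear_combination (TA + TB) * e1 + 2 * ((3 * m * |s|) ^ m * T) * e2
  linarith

lemma hmr_P4 {m θ : ℝ} (hm : 0 < m) (hθ : 0 < θ) (X V : Matrix N N ℝ) (hX : X.IsHermitian)
    (hV : V.PosSemidef) :
    trace (V * cfc (fun x : ℝ => |x| ^ m) X) ≤ θ * trace (cfc (fun x : ℝ => |x| ^ (m + 2)) X) +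
      θ⁻¹ ^ (m / 2) * trace (cfc (fun x : ℝ => x ^ ((m + 2) / 2)) V) := by
  obtain ⟨U, l, hU1, hU2, hAe, -, hAg⟩ := hmr_exists_diag X hX
  obtain ⟨W, a, hW1, hW2, hDe, ha, hDg⟩ := hmr_exists_diag V hV.1
  have ha0 : ∀ i, 0 ≤ a i := fun i => by rw [ha]; exact hV.eigenvalues_nonneg i
  have t1 : trace (V * cfc (fun x : ℝ => |x| ^ m) X) =
      ∑ i, ∑ j, (Uᵀ * W) i j ^ 2 * (a j * |l i| ^ m) := by
    rw [hAg]; conv_lhs => rw [hDe]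
    rw [hmr_tr_two]
  have t2 : trace (cfc (fun x : ℝ => x ^ ((m + 2) / 2)) V) =
      ∑ i, ∑ j, (Uᵀ * W) i j ^ 2 * (a j ^ ((m + 2) / 2)) := by
    have := hmr_tr_two U W (fun _ => 1) (fun j => a j ^ ((m + 2) / 2))
    rw [diagonal_one, Matrix.mul_one, hU1, Matrix.mul_one, ← hDg (fun x => x ^ ((m + 2) / 2))] at this
    rw [this]; simp only [mul_one]
  have t3 : trace (cfc (fun x : ℝ => |x| ^ (m + 2)) X) =
      ∑ i, ∑ j, (Uᵀ * W) i j ^ 2 * (|l i| ^ (m + 2)) := by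
    have := hmr_tr_two U W (fun i => |l i| ^ (m + 2)) (fun _ => 1)
    rw [diagonal_one, Matrix.mul_one, hW1, Matrix.one_mul, ← hAg (fun x => |x| ^ (m + 2))] at this
    rw [this]; simp only [one_mul]
  rw [t1, t2, t3]
  simp only [Finset.mul_sum, ← Finset.sum_add_distrib]
  refine Finset.sum_le_sum fun i _ => Finset.sum_le_sum fun j _ => ?_
  have := mul_le_mul_of_nonneg_left (hmr_young2 hm hθ (a j) (l i) (ha0 j)) (sq_nonneg ((Uᵀ * W) i j))
  nlinarith [this]

lemma hmr_P3 {m : ℝ} (hm : 0 < m) (X : Matrix N N ℝ) (hX : X.IsHermitian) :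
    trace (X * cfc (fun x : ℝ => x * |x| ^ m) X) = trace (cfc (fun x : ℝ => |x| ^ (m + 2)) X) := by
  obtain ⟨U, l, hU1, hU2, hAe, -, hAg⟩ := hmr_exists_diag X hX
  rw [hAg, hAg]
  have : X * (U * diagonal (fun i => l i * |l i| ^ m) * Uᵀ) =
      U * diagonal (fun i => |l i| ^ (m + 2)) * Uᵀ := by
    conv_lhs => rw [hAe]
    calc _ = U * (diagonal l * (Uᵀ * U) * diagonal (fun i => l i * |l i| ^ m)) * Uᵀ := by
          simp only [Matrix.mul_assoc]
      _ = _ := by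
          rw [hU2, Matrix.mul_one, diagonal_mul_diagonal]
          congr; ext i
          have : |l i| ^ (m + 2) = |l i| ^ m * |l i| ^ 2 := by
            rw [← Real.rpow_natCast _ 2, ← Real.rpow_add' (abs_nonneg _) (by norm_num; linarith)]; norm_num
          rw [this, sq_abs]; ring
  rw [this]

lemma hmr_tr_cfc_nonneg (g : ℝ → ℝ) (hg : ∀ x, 0 ≤ g x) (X : Matrix N N ℝ) (hX : X.IsHermitian) :
    0 ≤ trace (cfc g X) := by
  obtain ⟨U, l, hU1, hU2, hAe, -, hAg⟩ := hmr_exists_diag X hX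
  rw [hAg, Matrix.trace_mul_comm, ← Matrix.mul_assoc, hU2, Matrix.one_mul, trace_diagonal]
  exact Finset.sum_nonneg fun i _ => hg _

lemma hmr_tr_cfc_roots (g : ℝ → ℝ) (X : Matrix N N ℝ) (hX : X.IsHermitian) :
    trace (cfc g X) = (X.charpoly.roots.map g).sum := by
  obtain ⟨U, l, hU1, hU2, hAe, hl, hAg⟩ := hmr_exists_diag X hX
  rw [hAg, Matrix.trace_mul_comm, ← Matrix.mul_assoc, hU2, Matrix.one_mul, trace_diagonal,
    hX.roots_charpoly_eq_eigenvalues, Multiset.map_map, hl]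
  rfl

open scoped Matrix.Norms.L2Operator in
lemma hmr_cont_cfc {Y : Type*} [TopologicalSpace Y] (g : ℝ → ℝ) (hg : Continuous g)
    (X : Y → Matrix N N ℝ) (hX : Continuous X) (hH : ∀ y, (X y).IsHermitian) :
    Continuous fun y => cfc g (X y) := by
  exact Continuous.cfc_of_mem_nhdsSet (s := Set.univ) g Filter.univ_mem hX (fun y => (hH y).isSelfAdjoint)
    hg.continuousOn

end spectral

/-! ### probabilistic step -/

section prob
variable {Ω : Type*} [MeasurableSpace Ω] (μ : Measure Ω) [IsProbabilityMeasure μ]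

lemma hmr_integrable {n : ℕ} (x : Fin n → Ω → ℝ) (L : ℝ) (hmeas : ∀ i, Measurable (x i))
    (hbdd : ∀ i, ∀ᵐ ω ∂μ, |x i ω| ≤ L) (φ : (Fin n → ℝ) → ℝ) (hφ : Continuous φ) :
    Integrable (fun ω => φ fun i => x i ω) μ := by
  have hK : IsCompact (Set.pi Set.univ fun _ : Fin n => Set.Icc (-L) L) :=
    isCompact_univ_pi fun _ => isCompact_Icc
  obtain ⟨c, hc⟩ := hK.exists_bound_of_continuousOn hφ.continuousOn
  have hm : Measurable fun ω => (fun i => x i ω) := measurable_pi_lambda _ hmeas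
  refine Integrable.of_bound (hφ.measurable.comp hm).aestronglyMeasurable c ?_
  filter_upwards [ae_all_iff.2 hbdd] with ω hω
  exact hc _ fun i _ => ⟨(abs_le.1 (hω i)).1, (abs_le.1 (hω i)).2⟩

lemma hmr_indep {n : ℕ} (x : Fin n → Ω → ℝ) (hmeas : ∀ i, Measurable (x i))
    (hindep : iIndepFun x μ) (i : Fin n) (φ : ℝ → ℝ) (hφ : Continuous φ)
    (g : (Fin n → ℝ) → ℝ) (hg : Continuous g) (hgi : ∀ v, g (Function.update v i 0) = g v) :
    ∫ ω, φ (x i ω) * g (fun j => x j ω) ∂μ =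
      (∫ ω, φ (x i ω) ∂μ) * ∫ ω, g (fun j => x j ω) ∂μ := by
  have h := hindep.indepFun_finset {i} (Finset.univ.erase i) (by simp) hmeas
  have hp : Measurable fun u : ((j : {j // j ∈ Finset.univ.erase i}) → ℝ) =>
      (fun j : Fin n => if hj : j ∈ Finset.univ.erase i then u ⟨j, hj⟩ else 0) := by
    refine measurable_pi_lambda _ fun j => ?_
    by_cases hj : j ∈ Finset.univ.erase i
    · simp only [hj, dite_true]; exact measurable_pi_apply _
    · simp only [hj, dite_false]; exact measurable_const
  have hq : Measurable fun u : ((j : {j // j ∈ ({i} : Finset (Fin n))}) → ℝ) =>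
      φ (u ⟨i, Finset.mem_singleton_self i⟩) :=
    hφ.measurable.comp (measurable_pi_apply _)
  have h2 := h.comp (φ := fun u => φ (u ⟨i, Finset.mem_singleton_self i⟩))
    (ψ := fun u => g fun j : Fin n => if hj : j ∈ Finset.univ.erase i then u ⟨j, hj⟩ else 0)
    hq (hg.measurable.comp hp)
  have e : ∀ ω, g (fun j => if hj : j ∈ Finset.univ.erase i then x j ω else 0) =
      g (fun j => x j ω) := by
    intro ω
    rw [← hgi (fun j => x j ω)]
    congr 1
    ext j
    by_cases hj : j = i
    · subst hj; simp
    · simp [hj]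
  have hm : Measurable fun ω => (fun i => x i ω) := measurable_pi_lambda _ hmeas
  have h3 : IndepFun (fun ω => φ (x i ω)) (fun ω => g (fun j => x j ω)) μ := by
    have e2 : (fun ω => g (fun j => x j ω)) =
        fun ω => g (fun j => if hj : j ∈ Finset.univ.erase i then x j ω else 0) := by
      ext ω
      exact (e ω).symm
    rw [e2]
    exact h2
  exact h3.integral_fun_mul_eq_mul_integral
    (hφ.measurable.comp (hmeas i)).aestronglyMeasurable
    (hg.measurable.comp hm).aestronglyMeasurable

variable {N : Type*} [Fintype N] [DecidableEq N]

lemma hmr_cont_tr {Y : Type*} [TopologicalSpace Y] (g : ℝ → ℝ) (hg : Continuous g)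
    (X K : Y → Matrix N N ℝ) (hX : Continuous X) (hK : Continuous K) (hH : ∀ y, (X y).IsHermitian) :
    Continuous fun y => trace (K y * cfc g (X y)) :=
  (hK.matrix_mul (hmr_cont_cfc g hg X hX hH)).matrix_trace

lemma hmr_cont_tr' {Y : Type*} [TopologicalSpace Y] (g : ℝ → ℝ) (hg : Continuous g)
    (X : Y → Matrix N N ℝ) (hX : Continuous X) (hH : ∀ y, (X y).IsHermitian) :
    Continuous fun y => trace (cfc g (X y)) :=
  (hmr_cont_cfc g hg X hX hH).matrix_trace

lemma hmr_cont_abs {r : ℝ} (hr : 0 < r) : Continuous fun x : ℝ => |x| ^ r :=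
  continuous_abs.rpow_const fun _ => Or.inr hr.le

lemma hmr_step_i {n : ℕ} (x : Fin n → Ω → ℝ) (L : ℝ) (hL : 0 ≤ L) (hmeas : ∀ i, Measurable (x i))
    (hindep : iIndepFun x μ) (hmean : ∀ i, ∫ ω, x i ω ∂μ = 0)
    (hvar : ∀ i, ∫ ω, (x i ω) ^ 2 ∂μ = 1)
    (hbdd : ∀ i, ∀ᵐ ω ∂μ, |x i ω| ≤ L) {m : ℝ} (hm : 2 < m)
    (X D : (Fin n → ℝ) → Matrix N N ℝ) (i : Fin n)
    (hXc : Continuous X) (hDc : Continuous D) (hXH : ∀ v, (X v).IsHermitian)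
    (hDH : ∀ v, (D v).IsHermitian)
    (hX : ∀ v, X v = X (Function.update v i 0) + v i • D v)
    (hD : ∀ v, D (Function.update v i 0) = D v) :
    ∫ ω, x i ω * trace (D (fun j => x j ω) * cfc (fun s : ℝ => s * |s| ^ m) (X fun j => x j ω)) ∂μ ≤
      (m + 1) * (6 * ∫ ω, trace (D (fun j => x j ω) * D (fun j => x j ω) *
          cfc (fun s : ℝ => |s| ^ m) (X fun j => x j ω)) ∂μ +
        2 * (3 * m * L) ^ m * ∫ ω, trace (cfc (fun s : ℝ => |s| ^ (m + 2)) (D fun j => x j ω)) ∂μ) := by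
  have hm0 : 0 < m := by linarith
  have cf : Continuous fun s : ℝ => s * |s| ^ m := continuous_id.mul (hmr_cont_abs hm0)
  have cg := hmr_cont_abs hm0
  have cp := hmr_cont_abs (show 0 < m + 2 by linarith)
  have cu : Continuous fun v : Fin n → ℝ => Function.update v i 0 :=
    continuous_id.update i continuous_const
  have cX0 : Continuous fun v => X (Function.update v i 0) := hXc.comp cu
  set a := fun v => trace (D v * cfc (fun s : ℝ => s * |s| ^ m) (X v)) with ha
  set a0 := fun v => trace (D v * cfc (fun s : ℝ => s * |s| ^ m) (X (Function.update v i 0))) with ha0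
  set k := fun v => trace (D v * D v * cfc (fun s : ℝ => |s| ^ m) (X v)) with hk
  set k0 := fun v => trace (D v * D v * cfc (fun s : ℝ => |s| ^ m) (X (Function.update v i 0))) with hk0
  set T := fun v => trace (cfc (fun s : ℝ => |s| ^ (m + 2)) (D v)) with hT
  have ca : Continuous a := hmr_cont_tr _ cf X D hXc hDc hXH
  have ca0 : Continuous a0 := hmr_cont_tr _ cf _ D cX0 hDc fun v => hXH _
  have ck : Continuous k := hmr_cont_tr _ cg X _ hXc (hDc.matrix_mul hDc) hXH
  have ck0 : Continuous k0 := hmr_cont_tr _ cg _ _ cX0 (hDc.matrix_mul hDc) fun v => hXH _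
  have cT : Continuous T := hmr_cont_tr' _ cp D hDc hDH
  have ua0 : ∀ v, a0 (Function.update v i 0) = a0 v := by intro v; simp [ha0, hD]
  have uk0 : ∀ v, k0 (Function.update v i 0) = k0 v := by intro v; simp [hk0, hD]
  have uT : ∀ v, T (Function.update v i 0) = T v := by intro v; simp [hT, hD]
  have T0 : ∀ v, 0 ≤ T v := fun v => hmr_tr_cfc_nonneg _ (fun x => by positivity) _ (hDH v)
  have I : ∀ φ : (Fin n → ℝ) → ℝ, Continuous φ → Integrable (fun ω => φ fun i => x i ω) μ :=
    fun φ hφ => hmr_integrable μ x L hmeas hbdd φ hφ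
  have p1 : ∀ v, v i * a v ≤ v i * a0 v + v i ^ 2 * ((m + 1) * (k v + k0 v)) := fun v =>
    hmr_P1 (by linarith) (X v) (X (Function.update v i 0)) (D v) (hXH _) (hXH _) (hDH _) _ (hX v)
  have p2 : ∀ v, k v ≤ 2 * k0 v + 1 / 2 * (3 * m * |v i|) ^ m * T v := fun v =>
    hmr_P2 hm (X v) (X (Function.update v i 0)) (D v) (hXH _) (hXH _) (hDH _) _ (hX v)
  have p3 : ∀ v, k0 v ≤ 2 * k v + 1 / 2 * (3 * m * |v i|) ^ m * T v := fun v => by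
    have := hmr_P2 hm (X (Function.update v i 0)) (X v) (D v) (hXH _) (hXH _) (hDH _) (-(v i)) (by
      rw [hX v]; simp)
    rwa [abs_neg] at this
  have q : ∀ v : Fin n → ℝ, |v i| ≤ L → (3 * m * |v i|) ^ m * T v ≤ (3 * m * L) ^ m * T v := by
    intro v hv
    have := T0 v
    gcongr
  set R := (3 * m * L) ^ m with hR
  -- first integral inequality
  have i1 : ∫ ω, x i ω * a (fun j => x j ω) ∂μ ≤
      ∫ ω, (x i ω * a0 (fun j => x j ω) + ((m + 1) * (3 * (x i ω ^ 2 * k0 fun j => x j ω)) +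
        (m + 1) * (1 / 2 * R * (x i ω ^ 2 * T fun j => x j ω)))) ∂μ := by
    refine integral_mono_ae (I (fun v => v i * a v) (by fun_prop))
      (I (fun v => v i * a0 v + ((m + 1) * (3 * (v i ^ 2 * k0 v)) +
        (m + 1) * (1 / 2 * R * (v i ^ 2 * T v)))) (by fun_prop)) ?_
    filter_upwards [hbdd i] with ω hω
    have b1 := p1 (fun j => x j ω)
    have b2 := p2 (fun j => x j ω)
    have b3 := q (fun j => x j ω) hω
    refine b1.trans ?_
    have : (x i ω) ^ 2 * ((m + 1) * (k (fun j => x j ω) + k0 fun j => x j ω)) ≤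
      (x i ω) ^ 2 * ((m + 1) * (3 * (k0 fun j => x j ω) + 1 / 2 * (R * T fun j => x j ω))) := by
      refine mul_le_mul_of_nonneg_left (mul_le_mul_of_nonneg_left ?_ (by linarith)) (sq_nonneg _)
      linarith
    linarith
  have i2 : ∫ ω, k0 (fun j => x j ω) ∂μ ≤
      ∫ ω, (2 * k (fun j => x j ω) + 1 / 2 * R * T (fun j => x j ω)) ∂μ := by
    refine integral_mono_ae (I k0 ck0) (I (fun v => 2 * k v + 1 / 2 * R * T v) (by fun_prop)) ?_
    filter_upwards [hbdd i] with ω hω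
    have b2 := p3 (fun j => x j ω)
    have b3 := q (fun j => x j ω) hω
    linarith
  have z1 : ∫ ω, x i ω * a0 (fun j => x j ω) ∂μ = 0 := by
    have := hmr_indep μ x hmeas hindep i (fun s => s) continuous_id a0 ca0 ua0
    rw [this, hmean, zero_mul]
  have z2 : ∫ ω, x i ω ^ 2 * k0 (fun j => x j ω) ∂μ = ∫ ω, k0 (fun j => x j ω) ∂μ := by
    have := hmr_indep μ x hmeas hindep i (fun s => s ^ 2) (by fun_prop) k0 ck0 uk0
    rw [this, hvar, one_mul]
  have z3 : ∫ ω, x i ω ^ 2 * T (fun j => x j ω) ∂μ = ∫ ω, T (fun j => x j ω) ∂μ := by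
    have := hmr_indep μ x hmeas hindep i (fun s => s ^ 2) (by fun_prop) T cT uT
    rw [this, hvar, one_mul]
  rw [integral_add (I (fun v => v i * a0 v) (by fun_prop)) (I (fun v => ((m + 1) * (3 * (v i ^ 2 * k0 v)) +
        (m + 1) * (1 / 2 * R * (v i ^ 2 * T v)))) (by fun_prop)),
    integral_add (I (fun v => ((m + 1) * (3 * (v i ^ 2 * k0 v)))) (by fun_prop))
      (I (fun v => (m + 1) * (1 / 2 * R * (v i ^ 2 * T v))) (by fun_prop)), z1] at i1
  simp only [integral_const_mul] at i1
  rw [z2, z3] at i1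
  rw [integral_add (I (fun v => 2 * k v) (by fun_prop)) (I (fun v => 1 / 2 * R * T v) (by fun_prop)),
    integral_const_mul, integral_const_mul] at i2
  refine i1.trans ?_
  have := mul_le_mul_of_nonneg_left i2 (show 0 ≤ (m + 1) * 3 by linarith)
  nlinarith [this]

lemma hmr_step {n : ℕ} (x : Fin n → Ω → ℝ) (L : ℝ) (hL : 0 ≤ L) (hmeas : ∀ i, Measurable (x i))
    (hindep : iIndepFun x μ) (hmean : ∀ i, ∫ ω, x i ω ∂μ = 0)
    (hvar : ∀ i, ∫ ω, (x i ω) ^ 2 ∂μ = 1)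
    (hbdd : ∀ i, ∀ᵐ ω ∂μ, |x i ω| ≤ L) {m : ℝ} (hm : 2 < m)
    (X : (Fin n → ℝ) → Matrix N N ℝ) (D : Fin n → (Fin n → ℝ) → Matrix N N ℝ)
    (hXc : Continuous X) (hDc : ∀ i, Continuous (D i)) (hXH : ∀ v, (X v).IsHermitian)
    (hDH : ∀ i v, (D i v).IsHermitian)
    (hX : ∀ i v, X v = X (Function.update v i 0) + v i • D i v)
    (hD : ∀ i v, D i (Function.update v i 0) = D i v)
    (d : ℕ) (hd : 1 ≤ d) (hE : ∀ v, ∑ i, v i • D i v = (d : ℝ) • X v) :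
    ∫ ω, trace (cfc (fun s : ℝ => |s| ^ (m + 2)) (X fun j => x j ω)) ∂μ ≤
      (12 * (m + 2)) ^ ((m + 2) / 2) *
        ∫ ω, trace (cfc (fun s : ℝ => s ^ ((m + 2) / 2))
          (∑ i, D i (fun j => x j ω) * D i (fun j => x j ω))) ∂μ +
      4 * (m + 2) * (3 * m * L) ^ m *
        ∑ i, ∫ ω, trace (cfc (fun s : ℝ => |s| ^ (m + 2)) (D i fun j => x j ω)) ∂μ := by
  have hm0 : 0 < m := by linarith
  have cf : Continuous fun s : ℝ => s * |s| ^ m := continuous_id.mul (hmr_cont_abs hm0)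
  have cg := hmr_cont_abs hm0
  have cp := hmr_cont_abs (show 0 < m + 2 by linarith)
  have cq : Continuous fun s : ℝ => s ^ ((m + 2) / 2) :=
    continuous_id.rpow_const fun _ => Or.inr (by positivity)
  have I : ∀ φ : (Fin n → ℝ) → ℝ, Continuous φ → Integrable (fun ω => φ fun i => x i ω) μ :=
    fun φ hφ => hmr_integrable μ x L hmeas hbdd φ hφ
  set V := fun v => ∑ i, D i v * D i v with hV
  have cV : Continuous V := continuous_finsetSum _ fun i _ => (hDc i).matrix_mul (hDc i)
  have VP : ∀ v, (V v).PosSemidef := by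
    intro v
    refine Matrix.posSemidef_sum _ fun i _ => ?_
    have := Matrix.posSemidef_conjTranspose_mul_self (D i v)
    rwa [(hDH i v).eq] at this
  set P := fun v => trace (cfc (fun s : ℝ => |s| ^ (m + 2)) (X v)) with hP
  set Q := fun v => trace (cfc (fun s : ℝ => s ^ ((m + 2) / 2)) (V v)) with hQ
  have cP : Continuous P := hmr_cont_tr' _ cp X hXc hXH
  have cQ : Continuous Q := hmr_cont_tr' _ cq V cV fun v => (VP v).1
  have P0 : ∀ v, 0 ≤ P v := fun v => hmr_tr_cfc_nonneg _ (fun x => by positivity) _ (hXH v)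
  have ca : ∀ i, Continuous fun v => trace (D i v * cfc (fun s : ℝ => s * |s| ^ m) (X v)) :=
    fun i => hmr_cont_tr _ cf X (D i) hXc (hDc i) hXH
  have ck : ∀ i, Continuous fun v => trace (D i v * D i v * cfc (fun s : ℝ => |s| ^ m) (X v)) :=
    fun i => hmr_cont_tr _ cg X _ hXc ((hDc i).matrix_mul (hDc i)) hXH
  have e1 : ∀ v, (d : ℝ) * P v = ∑ i, v i * trace (D i v * cfc (fun s : ℝ => s * |s| ^ m) (X v)) := by
    intro v
    have : trace (((d : ℝ) • X v) * cfc (fun s : ℝ => s * |s| ^ m) (X v)) = (d : ℝ) * P v := by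
      rw [smul_mul, trace_smul, hmr_P3 hm0 _ (hXH v), smul_eq_mul]
    rw [← this, ← hE, Finset.sum_mul, trace_sum]
    simp only [smul_mul, trace_smul, smul_eq_mul]
  have e2 : ∀ v, ∑ i, trace (D i v * D i v * cfc (fun s : ℝ => |s| ^ m) (X v)) ≤
      (12 * (m + 2))⁻¹ * P v + (12 * (m + 2)) ^ (m / 2) * Q v := by
    intro v
    have := hmr_P4 hm0 (θ := (12 * (m + 2))⁻¹) (by positivity) (X v) (V v) (hXH v) (VP v)
    rw [inv_inv] at this
    refine le_trans (le_of_eq ?_) this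
    rw [hV, Finset.sum_mul, trace_sum]
  have j1 : (d : ℝ) * ∫ ω, P (fun j => x j ω) ∂μ ≤ ∑ i, (m + 1) * (6 * ∫ ω, trace (D i (fun j => x j ω) * D i (fun j => x j ω) *
          cfc (fun s : ℝ => |s| ^ m) (X fun j => x j ω)) ∂μ +
        2 * (3 * m * L) ^ m * ∫ ω, trace (cfc (fun s : ℝ => |s| ^ (m + 2)) (D i fun j => x j ω)) ∂μ) := by
    rw [← integral_const_mul]
    simp only [e1]
    rw [integral_finsetSum _ fun i _ => I (fun v => v i * trace (D i v * cfc (fun s : ℝ => s * |s| ^ m) (X v)))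
      ((continuous_apply i).mul (ca i))]
    exact Finset.sum_le_sum fun i _ => hmr_step_i μ x L hL hmeas hindep hmean hvar hbdd hm X (D i) i hXc
      (hDc i) hXH (hDH i) (hX i) (hD i)
  have j2 : ∑ i, ∫ ω, trace (D i (fun j => x j ω) * D i (fun j => x j ω) *
          cfc (fun s : ℝ => |s| ^ m) (X fun j => x j ω)) ∂μ ≤
      (12 * (m + 2))⁻¹ * ∫ ω, P (fun j => x j ω) ∂μ + (12 * (m + 2)) ^ (m / 2) * ∫ ω, Q (fun j => x j ω) ∂μ := by
    rw [← integral_finsetSum _ fun i _ => I _ (ck i), ← integral_const_mul, ← integral_const_mul,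
      ← integral_add ((I _ cP).const_mul _) ((I _ cQ).const_mul _)]
    refine integral_mono (I (fun v => ∑ i, trace (D i v * D i v * cfc (fun s : ℝ => |s| ^ m) (X v)))
      (continuous_finsetSum _ fun i _ => ck i)) (((I _ cP).const_mul _).add ((I _ cQ).const_mul _)) fun ω => ?_
    exact e2 _
  have M0 : 0 ≤ ∫ ω, P (fun j => x j ω) ∂μ := integral_nonneg fun ω => P0 _
  have Q0 : 0 ≤ ∫ ω, Q (fun j => x j ω) ∂μ := integral_nonneg fun ω => by
    show 0 ≤ trace _
    rw [hmr_tr_cfc_roots _ _ (VP _).1, (VP _).1.roots_charpoly_eq_eigenvalues, Multiset.map_map]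
    exact Finset.sum_nonneg fun i _ => Real.rpow_nonneg ((VP _).eigenvalues_nonneg i) _
  have S0 : 0 ≤ ∑ i, ∫ ω, trace (cfc (fun s : ℝ => |s| ^ (m + 2)) (D i fun j => x j ω)) ∂μ :=
    Finset.sum_nonneg fun i _ => integral_nonneg fun ω =>
      hmr_tr_cfc_nonneg _ (fun x => by positivity) _ (hDH i _)
  rw [← Finset.mul_sum, Finset.sum_add_distrib, ← Finset.mul_sum, ← Finset.mul_sum] at j1
  set M := ∫ ω, P (fun j => x j ω) ∂μ
  set QQ := ∫ ω, Q (fun j => x j ω) ∂μ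
  set S := ∑ i, ∫ ω, trace (cfc (fun s : ℝ => |s| ^ (m + 2)) (D i fun j => x j ω)) ∂μ
  set R := (3 * m * L) ^ m
  have R0 : 0 ≤ R := by positivity
  have hd' : (1 : ℝ) ≤ d := by exact_mod_cast hd
  have pw : (12 * (m + 2)) ^ ((m + 2) / 2) = (12 * (m + 2)) ^ (m / 2) * (12 * (m + 2)) := by
    rw [← Real.rpow_add_one (by positivity)]; congr 1; ring
  rw [pw]
  set B := (12 * (m + 2)) ^ (m / 2)
  have B0 : 0 ≤ B := by positivity
  have k1 : M ≤ d * M := by nlinarith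
  have k2 : (m + 1) * 6 * ((12 * (m + 2))⁻¹ * M) ≤ 1 / 2 * M := by
    have : (m + 1) * 6 * (12 * (m + 2))⁻¹ ≤ 1 / 2 := by
      rw [← div_eq_mul_inv, div_le_iff₀ (by positivity)]; linarith
    nlinarith
  have k3 := mul_le_mul_of_nonneg_left j2 (show 0 ≤ (m + 1) * 6 by linarith)
  have BQ : 0 ≤ B * QQ := by positivity
  have RS : 0 ≤ R * S := by positivity
  nlinarith
end prob

/-! ### Schatten sums via characteristic polynomials -/

section schatten
variable {R C : Type*} [Fintype R] [Fintype C] [DecidableEq R] [DecidableEq C]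

lemma hmr_S_eq (q : ℝ) (A : Matrix R C ℝ) :
    schattenPow q A = ((Aᵀ * A).charpoly.roots.map (fun s : ℝ => s ^ q)).sum := by
  have h := (Matrix.isHermitian_conjTranspose_mul_self A).roots_charpoly_eq_eigenvalues
  rw [← conjTranspose_eq_transpose_of_trivial, h, Multiset.map_map]
  rfl

lemma hmr_S_nonneg (q : ℝ) (A : Matrix R C ℝ) : 0 ≤ schattenPow q A :=
  Finset.sum_nonneg fun i _ =>
    Real.rpow_nonneg ((Matrix.posSemidef_conjTranspose_mul_self A).eigenvalues_nonneg i) _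

lemma hmr_S_reindex {R' C' : Type*} [Fintype R'] [Fintype C'] [DecidableEq R'] [DecidableEq C']
    (q : ℝ) (A : Matrix R C ℝ) (e : R' ≃ R) (f : C' ≃ C) :
    schattenPow q (A.submatrix e f) = schattenPow q A := by
  rw [hmr_S_eq, hmr_S_eq]
  have : (A.submatrix e f)ᵀ * A.submatrix e f = reindex f.symm f.symm (Aᵀ * A) := by
    rw [transpose_submatrix, submatrix_mul_equiv, reindex_apply]; rfl
  rw [this, charpoly_reindex]

lemma hmr_S_T {q : ℝ} (hq : q ≠ 0) (A : Matrix R C ℝ) :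
    ((A * Aᵀ).charpoly.roots.map (fun s : ℝ => s ^ q)).sum = schattenPow q A := by
  rw [hmr_S_eq]
  have h := congrArg Polynomial.roots (charpoly_mul_comm' A Aᵀ)
  have n1 := (charpoly_monic (A * Aᵀ)).ne_zero
  have n2 := (charpoly_monic (Aᵀ * A)).ne_zero
  rw [Polynomial.roots_mul (mul_ne_zero (pow_ne_zero _ Polynomial.X_ne_zero) n1),
    Polynomial.roots_mul (mul_ne_zero (pow_ne_zero _ Polynomial.X_ne_zero) n2)] at h
  have h2 := congrArg (fun s => (Multiset.map (fun s : ℝ => s ^ q) s).sum) h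
  simpa [Polynomial.roots_pow, Real.zero_rpow hq, Multiset.map_nsmul, Multiset.sum_nsmul] using h2

def hmrDil (A : Matrix R C ℝ) : Matrix (R ⊕ C) (R ⊕ C) ℝ := fromBlocks 0 A Aᵀ 0

lemma hmrDil_herm (A : Matrix R C ℝ) : (hmrDil A).IsHermitian := by
  simp [hmrDil, IsHermitian, fromBlocks_transpose]

lemma hmrDil_sq (A : Matrix R C ℝ) : hmrDil A * hmrDil A = fromBlocks (A * Aᵀ) 0 0 (Aᵀ * A) := by
  simp [hmrDil, fromBlocks_multiply]

lemma hmr_tr_blocks (g : ℝ → ℝ) (P : Matrix R R ℝ) (Q : Matrix C C ℝ) (hP : P.IsHermitian)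
    (hQ : Q.IsHermitian) :
    trace (cfc g (fromBlocks P 0 0 Q)) =
      (P.charpoly.roots.map g).sum + (Q.charpoly.roots.map g).sum := by
  rw [hmr_tr_cfc_roots _ _ (by
    rw [IsHermitian, fromBlocks_conjTranspose, hP.eq, hQ.eq]; simp), charpoly_fromBlocks_zero₁₂,
    Polynomial.roots_mul (mul_ne_zero (charpoly_monic _).ne_zero (charpoly_monic _).ne_zero),
    Multiset.map_add, Multiset.sum_add]

lemma hmr_herm1 (A : Matrix R C ℝ) : (A * Aᵀ).IsHermitian := by
  simpa using isHermitian_mul_conjTranspose_self A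

lemma hmr_herm2 (A : Matrix R C ℝ) : (Aᵀ * A).IsHermitian := by
  simpa using isHermitian_conjTranspose_mul_self A

lemma hmr_tr_sq {N : Type*} [Fintype N] [DecidableEq N] (q : ℝ) (X : Matrix N N ℝ)
    (hX : X.IsHermitian) :
    trace (cfc (fun s : ℝ => |s| ^ (2 * q)) X) = trace (cfc (fun s : ℝ => s ^ q) (X * X)) := by
  have h : X * X = cfc (fun s : ℝ => s ^ 2) X := by
    rw [cfc_pow_id X 2 hX.isSelfAdjoint, sq]
  have h2 := cfc_comp (fun s : ℝ => s ^ q) (fun s : ℝ => s ^ 2) X hX.isSelfAdjoint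
    (Set.Finite.continuousOn (Matrix.finite_real_spectrum.image _) _)
    (Set.Finite.continuousOn Matrix.finite_real_spectrum _)
  rw [h, ← h2]
  congr 2
  ext s
  rw [Function.comp_apply, ← sq_abs, ← Real.rpow_natCast, ← Real.rpow_mul (abs_nonneg _)]
  norm_num

lemma hmr_S_dil {q : ℝ} (hq : q ≠ 0) (A : Matrix R C ℝ) :
    trace (cfc (fun s : ℝ => |s| ^ (2 * q)) (hmrDil A)) = 2 * schattenPow q A := by
  rw [hmr_tr_sq q _ (hmrDil_herm A), hmrDil_sq, hmr_tr_blocks _ _ _ (hmr_herm1 A) (hmr_herm2 A),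
    hmr_S_T hq, ← hmr_S_eq]
  ring

def hmrVert {n : ℕ} (E : Fin n → Matrix R C ℝ) : Matrix (Fin n × R) C ℝ :=
  Matrix.of fun p c => E p.1 p.2 c
def hmrHorz {n : ℕ} (E : Fin n → Matrix R C ℝ) : Matrix R (Fin n × C) ℝ :=
  Matrix.of fun r p => E p.1 r p.2
def hmrDiag {n : ℕ} (E : Fin n → Matrix R C ℝ) : Matrix (Fin n × R) (Fin n × C) ℝ :=
  Matrix.of fun p s => if p.1 = s.1 then E p.1 p.2 s.2 else 0

lemma hmr_S_V {n : ℕ} {q : ℝ} (hq : q ≠ 0) (E : Fin n → Matrix R C ℝ) :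
    trace (cfc (fun s : ℝ => s ^ q) (∑ i, hmrDil (E i) * hmrDil (E i))) =
      schattenPow q (hmrHorz E) + schattenPow q (hmrVert E) := by
  have h : ∑ i, hmrDil (E i) * hmrDil (E i) =
      fromBlocks (hmrHorz E * (hmrHorz E)ᵀ) 0 0 ((hmrVert E)ᵀ * hmrVert E) := by
    simp only [hmrDil_sq]
    ext (a | a) (b | b) <;>
      simp [Matrix.sum_apply, Matrix.mul_apply, hmrHorz, hmrVert, Fintype.sum_prod_type]
  rw [h, hmr_tr_blocks _ _ _ (hmr_herm1 _) (hmr_herm2 _), hmr_S_T hq, ← hmr_S_eq]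

lemma hmr_S_diag {n : ℕ} (q : ℝ) (E : Fin n → Matrix R C ℝ) :
    schattenPow q (hmrDiag E) = ∑ i, schattenPow q (E i) := by
  have h : (hmrDiag E)ᵀ * hmrDiag E =
      reindex (Equiv.prodComm _ _) (Equiv.prodComm _ _) (blockDiagonal fun i => (E i)ᵀ * E i) := by
    ext ⟨i, a⟩ ⟨j, b⟩
    simp only [Matrix.mul_apply, hmrDiag, Fintype.sum_prod_type, transpose_apply, of_apply,
      reindex_apply, submatrix_apply, Equiv.prodComm_symm, Equiv.prodComm_apply, Prod.swap_prod_mk,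
      blockDiagonal_apply]
    by_cases hij : i = j
    · subst hij
      rw [Finset.sum_eq_single i]
      · simp
      · intro k _ hk; simp [hk]
      · simp
    · rw [if_neg hij]
      refine Finset.sum_eq_zero fun k _ => Finset.sum_eq_zero fun r _ => ?_
      by_cases hk : k = i
      · subst hk; simp [hij]
      · simp [hk]
  have h2 : (blockDiagonal fun i => (E i)ᵀ * E i).charpoly = ∏ i, ((E i)ᵀ * E i).charpoly := by
    simp only [Matrix.charpoly]
    rw [← det_blockDiagonal]
    congr 1
    ext ⟨a, i⟩ ⟨b, j⟩
    simp only [charmatrix_apply, blockDiagonal_apply, diagonal_apply]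
    by_cases hij : i = j
    · subst hij; simp [Prod.ext_iff]
    · simp [hij, Prod.ext_iff]
  rw [hmr_S_eq, h, charpoly_reindex, h2, Polynomial.roots_prod _ _
    (Finset.prod_ne_zero_iff.2 fun i _ => (charpoly_monic _).ne_zero), Multiset.map_bind,
    Multiset.sum_bind]
  simp only [hmr_S_eq]
  rfl

end schatten

/-! ### homogeneous multilinear polynomials -/

section hml
variable {n : ℕ} {R C : Type*}

noncomputable def hmrP (d : ℕ) (B : Finset (Fin n) → Matrix R C ℝ) (v : Fin n → ℝ) : Matrix R C ℝ :=
  ∑ S ∈ Finset.powersetCard d Finset.univ, (∏ i ∈ S, v i) • B S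

def hmrB (B : Finset (Fin n) → Matrix R C ℝ) (i : Fin n) (S : Finset (Fin n)) : Matrix R C ℝ :=
  if i ∈ S then 0 else B (insert i S)

lemma hmr_split {M : Type*} [AddCommMonoid M] (d : ℕ) (i : Fin n) (f : Finset (Fin n) → M) :
    ∑ S ∈ Finset.powersetCard (d + 1) Finset.univ, f S =
      ∑ S ∈ Finset.powersetCard (d + 1) (Finset.univ.erase i), f S +
      ∑ S ∈ Finset.powersetCard d (Finset.univ.erase i), f (insert i S) := by
  have h : (Finset.univ : Finset (Fin n)) = insert i (Finset.univ.erase i) := by simp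
  conv_lhs => rw [h]
  rw [Finset.powersetCard_succ_insert (by simp), Finset.sum_union, Finset.sum_image]
  · intro S hS T hT hST
    have hi : i ∉ S := fun hh => by
      have := (Finset.mem_powersetCard.1 hS).1 hh; simp at this
    have hi' : i ∉ T := fun hh => by
      have := (Finset.mem_powersetCard.1 hT).1 hh; simp at this
    rw [← Finset.erase_insert hi, hST, Finset.erase_insert hi']
  · rw [Finset.disjoint_left]
    intro S hS hS'
    obtain ⟨T, -, rfl⟩ := Finset.mem_image.1 hS'
    have := (Finset.mem_powersetCard.1 hS).1 (Finset.mem_insert_self i T)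
    simp at this

lemma hmr_D_eq (d : ℕ) (B : Finset (Fin n) → Matrix R C ℝ) (i : Fin n) (v : Fin n → ℝ) :
    hmrP d (hmrB B i) v = ∑ S ∈ Finset.powersetCard d (Finset.univ.erase i),
      (∏ j ∈ S, v j) • B (insert i S) := by
  have hs : Finset.powersetCard d (Finset.univ.erase i) ⊆ Finset.powersetCard d Finset.univ :=
    Finset.powersetCard_mono (Finset.subset_univ _)
  rw [hmrP, ← Finset.sum_subset hs]
  · refine Finset.sum_congr rfl fun S hS => ?_
    have hi : i ∉ S := fun hh => by
      have := (Finset.mem_powersetCard.1 hS).1 hh; simp at this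
    rw [hmrB, if_neg hi]
  · intro S hS hS'
    have hi : i ∈ S := by
      by_contra hi
      refine hS' (Finset.mem_powersetCard.2 ⟨fun j hj => ?_, (Finset.mem_powersetCard.1 hS).2⟩)
      rw [Finset.mem_erase]
      exact ⟨fun h => hi (h ▸ hj), Finset.mem_univ _⟩
    rw [hmrB, if_pos hi, smul_zero]

lemma hmr_vD (d : ℕ) (B : Finset (Fin n) → Matrix R C ℝ) (i : Fin n) (v : Fin n → ℝ) :
    v i • hmrP d (hmrB B i) v = ∑ S ∈ Finset.powersetCard d (Finset.univ.erase i),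
      (∏ j ∈ insert i S, v j) • B (insert i S) := by
  rw [hmr_D_eq, Finset.smul_sum]
  refine Finset.sum_congr rfl fun S hS => ?_
  have hi : i ∉ S := fun hh => by
    have := (Finset.mem_powersetCard.1 hS).1 hh; simp at this
  rw [Finset.prod_insert hi, smul_smul]

lemma hmr_prod_update {i : Fin n} {S : Finset (Fin n)} (hi : i ∉ S) (v : Fin n → ℝ) (c : ℝ) :
    ∏ j ∈ S, Function.update v i c j = ∏ j ∈ S, v j := by
  refine Finset.prod_congr rfl fun j hj => ?_
  rw [Function.update_of_ne]
  rintro rfl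
  exact hi hj

lemma hmr_D_indep (d : ℕ) (B : Finset (Fin n) → Matrix R C ℝ) (i : Fin n) (v : Fin n → ℝ) (c : ℝ) :
    hmrP d (hmrB B i) (Function.update v i c) = hmrP d (hmrB B i) v := by
  rw [hmr_D_eq, hmr_D_eq]
  refine Finset.sum_congr rfl fun S hS => ?_
  rw [hmr_prod_update]
  intro hh
  have := (Finset.mem_powersetCard.1 hS).1 hh; simp at this

lemma hmr_X_split (d : ℕ) (B : Finset (Fin n) → Matrix R C ℝ) (i : Fin n) (v : Fin n → ℝ) :
    hmrP (d + 1) B v =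
      hmrP (d + 1) B (Function.update v i 0) + v i • hmrP d (hmrB B i) v := by
  have h : ∀ u : Fin n → ℝ, hmrP (d + 1) B u =
      ∑ S ∈ Finset.powersetCard (d + 1) (Finset.univ.erase i), (∏ j ∈ S, u j) • B S
        + u i • hmrP d (hmrB B i) u := by
    intro u
    rw [hmr_vD, hmrP, hmr_split d i]
  rw [h v, h (Function.update v i 0)]
  congr 1
  rw [Function.update_self, zero_smul, add_zero]
  refine Finset.sum_congr rfl fun S hS => ?_
  rw [hmr_prod_update]
  intro hh
  have := (Finset.mem_powersetCard.1 hS).1 hh; simp at this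

lemma hmr_euler (d : ℕ) (B : Finset (Fin n) → Matrix R C ℝ) (v : Fin n → ℝ) :
    ∑ i, v i • hmrP d (hmrB B i) v = ((d + 1 : ℕ) : ℝ) • hmrP (d + 1) B v := by
  have h : ∀ i, v i • hmrP d (hmrB B i) v = ∑ S ∈ Finset.powersetCard (d + 1) Finset.univ,
      if i ∈ S then (∏ j ∈ S, v j) • B S else 0 := by
    intro i
    have h0 : (∑ S ∈ Finset.powersetCard (d + 1) (Finset.univ.erase i),
        if i ∈ S then (∏ j ∈ S, v j) • B S else 0) = 0 := by
      refine Finset.sum_eq_zero fun S hS => ?_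
      rw [if_neg]
      intro hh
      have := (Finset.mem_powersetCard.1 hS).1 hh; simp at this
    rw [hmr_vD, hmr_split d i, h0, zero_add]
    refine Finset.sum_congr rfl fun S hS => ?_
    rw [if_pos (Finset.mem_insert_self _ _)]
  simp only [h]
  rw [Finset.sum_comm, hmrP, Finset.smul_sum]
  refine Finset.sum_congr rfl fun S hS => ?_
  rw [← Finset.sum_filter, Finset.sum_const, ← (Finset.mem_powersetCard.1 hS).2]
  simp [Nat.cast_smul_eq_nsmul]

lemma hmr_P_cont (d : ℕ) (B : Finset (Fin n) → Matrix R C ℝ) : Continuous (hmrP d B) := by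
  unfold hmrP
  fun_prop

lemma hmr_P_apply (d : ℕ) (B : Finset (Fin n) → Matrix R C ℝ) (v : Fin n → ℝ) (r : R) (c : C) :
    hmrP d B v r c = ∑ S ∈ Finset.powersetCard d Finset.univ, (∏ i ∈ S, v i) * B S r c := by
  simp [hmrP, Matrix.sum_apply]

lemma hmr_pderiv (d : ℕ) (B : Finset (Fin n) → Matrix R C ℝ) (i : Fin n) :
    pderivAt (hmrP (d + 1) B) i = hmrP d (hmrB B i) := by
  ext v r c
  simp only [pderivAt, of_apply]
  have hdiff : DifferentiableAt ℝ (fun y => hmrP (d + 1) B y r c) v := by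
    simp only [hmr_P_apply]
    fun_prop
  rw [← hdiff.lineDeriv_eq_fderiv, lineDeriv]
  have h : ∀ s : ℝ, hmrP (d + 1) B (v + s • Pi.single i 1) r c =
      hmrP (d + 1) B (Function.update v i 0) r c + (v i + s) * hmrP d (hmrB B i) v r c := by
    intro s
    have e : v + s • Pi.single i 1 = Function.update v i (v i + s) := by
      ext j
      by_cases hj : j = i
      · subst hj; simp
      · simp [hj]
    rw [e, hmr_X_split d B i, hmr_D_indep]
    simp
  simp only [h]
  have hd : HasDerivAt (fun s : ℝ => hmrP (d + 1) B (Function.update v i 0) r c +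
      (v i + s) * hmrP d (hmrB B i) v r c) (1 * hmrP d (hmrB B i) v r c) 0 :=
    (((hasDerivAt_id (0 : ℝ)).const_add (v i)).mul_const _).const_add _
  rw [hd.deriv, one_mul]

def hmrCoef (B : Finset (Fin n) → Matrix R C ℝ) (s : Multiset (Fin n)) : Matrix R C ℝ :=
  if s.Nodup then B s.toFinset else 0

def hmrMs {k : ℕ} (w : Fin k → Fin n) : Multiset (Fin n) := Finset.univ.val.map w

lemma hmrMs_append {k l : ℕ} (w : Fin k → Fin n) (u : Fin l → Fin n) :
    hmrMs (Fin.append w u) = hmrMs w + hmrMs u := by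
  simp only [hmrMs, Fin.univ_val_map, List.ofFn_fin_append]
  rfl

lemma hmrMs_cons {k : ℕ} (i : Fin n) (w : Fin k → Fin n) :
    hmrMs (Fin.cons i w : Fin (k + 1) → Fin n) = i ::ₘ hmrMs w := by
  simp [hmrMs, Fin.univ_val_map, List.ofFn_cons]

lemma hmrMs_snoc {k : ℕ} (w : Fin (k + 1) → Fin n) :
    hmrMs w = w (Fin.last k) ::ₘ hmrMs (fun j : Fin k => w j.castSucc) := by
  simp only [hmrMs, Fin.univ_val_map, List.ofFn_succ', List.concat_eq_append]
  rw [← Multiset.coe_add, add_comm]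
  rfl

lemma hmrCoef_B (B : Finset (Fin n) → Matrix R C ℝ) (i : Fin n) (s : Multiset (Fin n)) :
    hmrCoef (hmrB B i) s = hmrCoef B (i ::ₘ s) := by
  simp only [hmrCoef, hmrB, Multiset.nodup_cons, Multiset.mem_toFinset, Multiset.toFinset_cons]
  by_cases h1 : s.Nodup <;> by_cases h2 : i ∈ s <;> simp [h1, h2]

lemma hmr_iter (k : ℕ) : ∀ (d e : ℕ) (he : e = d + k) (B : Finset (Fin n) → Matrix R C ℝ)
    (w : Fin k → Fin n),
    iterPDeriv (hmrP e B) w = hmrP d (fun S => hmrCoef B (hmrMs w + S.val)) := by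
  induction k with
  | zero =>
    intro d e he B w
    subst he
    simp only [iterPDeriv, Nat.add_zero]
    congr 1
    ext1 S
    simp [hmrMs, hmrCoef, S.nodup]
  | succ k ih =>
    intro d e he B w
    simp only [iterPDeriv]
    rw [ih (d + 1) e (by omega), hmr_pderiv]
    congr 1
    ext1 S
    rw [hmrB, hmrMs_snoc w]
    split_ifs with h
    · rw [hmrCoef, if_neg]
      rw [Multiset.cons_add, Multiset.nodup_cons]
      simp [h]
    · rw [Finset.insert_val_of_notMem h, Multiset.add_cons, Multiset.cons_add]

noncomputable def hmrBlk (B : Finset (Fin n) → Matrix R C ℝ) (a b c : ℕ) :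
    Matrix ((Fin a → Fin n) × (Fin c → Fin n) × R) ((Fin b → Fin n) × (Fin c → Fin n) × C) ℝ :=
  Matrix.of fun p q =>
    if p.2.1 = q.2.1 then hmrCoef B (hmrMs p.1 + hmrMs q.1 + hmrMs p.2.1) p.2.2 q.2.2 else 0

lemma hmr_derivBlocks (B : Finset (Fin n) → Matrix R C ℝ) {a b c d : ℕ} (h : a + b + c = d) :
    derivBlocks (hmrP d B) a b c 0 = hmrBlk B a b c := by
  ext p q
  simp only [derivBlocks, hmrBlk, of_apply]
  split_ifs
  · rw [hmr_iter (a + b + c) 0 d (by omega), hmrMs_append, hmrMs_append, hmrP]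
    simp
  · rfl

end hml

/-! ### one-step recursion and induction -/

section recursion
variable {n : ℕ} {R C : Type*} [Fintype R] [Fintype C] [DecidableEq R] [DecidableEq C]

def hmrEqA (n a c : ℕ) (R : Type*) :
    (Fin a → Fin n) × (Fin c → Fin n) × (Fin n × R) ≃ (Fin (a + 1) → Fin n) × (Fin c → Fin n) × R where
  toFun p := (Fin.cons p.2.2.1 p.1, p.2.1, p.2.2.2)
  invFun p := (Fin.tail p.1, p.2.1, (p.1 0, p.2.2))
  left_inv p := by simp
  right_inv p := by simp

def hmrEqC (n a c : ℕ) (R : Type*) :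
    (Fin a → Fin n) × (Fin c → Fin n) × (Fin n × R) ≃ (Fin a → Fin n) × (Fin (c + 1) → Fin n) × R where
  toFun p := (p.1, Fin.cons p.2.2.1 p.2.1, p.2.2.2)
  invFun p := (p.1, Fin.tail p.2.1, (p.2.1 0, p.2.2))
  left_inv p := by simp
  right_inv p := by simp

lemma hmr_coef_vert (B : Finset (Fin n) → Matrix R C ℝ) (s : Multiset (Fin n)) :
    hmrCoef (fun S => hmrVert fun i => hmrB B i S) s =
      hmrVert fun i => hmrCoef B (i ::ₘ s) := by
  ext p q
  simp only [← hmrCoef_B]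
  by_cases h : s.Nodup <;> simp [hmrCoef, h, hmrVert]

lemma hmr_coef_horz (B : Finset (Fin n) → Matrix R C ℝ) (s : Multiset (Fin n)) :
    hmrCoef (fun S => hmrHorz fun i => hmrB B i S) s =
      hmrHorz fun i => hmrCoef B (i ::ₘ s) := by
  ext p q
  simp only [← hmrCoef_B]
  by_cases h : s.Nodup <;> simp [hmrCoef, h, hmrHorz]

lemma hmr_coef_diag (B : Finset (Fin n) → Matrix R C ℝ) (s : Multiset (Fin n)) :
    hmrCoef (fun S => hmrDiag fun i => hmrB B i S) s =
      hmrDiag fun i => hmrCoef B (i ::ₘ s) := by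
  ext p q
  simp only [← hmrCoef_B]
  by_cases h : s.Nodup <;> simp [hmrCoef, h, hmrDiag]

lemma hmr_blk_vert (q : ℝ) (B : Finset (Fin n) → Matrix R C ℝ) (a b c : ℕ) :
    schattenPow q (hmrBlk (fun S => hmrVert fun i => hmrB B i S) a b c) =
      schattenPow q (hmrBlk B (a + 1) b c) := by
  rw [← hmr_S_reindex q (hmrBlk B (a + 1) b c) (hmrEqA n a c R) (Equiv.refl _)]
  congr 1
  ext p s
  simp only [hmrBlk, hmr_coef_vert]
  simp only [of_apply, submatrix_apply, hmrVert, hmrEqA, Equiv.coe_fn_mk,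
    Equiv.refl_apply, hmrMs_cons, Multiset.cons_add]

lemma hmr_blk_horz (q : ℝ) (B : Finset (Fin n) → Matrix R C ℝ) (a b c : ℕ) :
    schattenPow q (hmrBlk (fun S => hmrHorz fun i => hmrB B i S) a b c) =
      schattenPow q (hmrBlk B a (b + 1) c) := by
  rw [← hmr_S_reindex q (hmrBlk B a (b + 1) c) (Equiv.refl _) (hmrEqA n b c C)]
  congr 1
  ext p s
  simp only [hmrBlk, hmr_coef_horz]
  simp only [of_apply, submatrix_apply, hmrHorz, hmrEqA, Equiv.coe_fn_mk,
    Equiv.refl_apply, hmrMs_cons, Multiset.cons_add, Multiset.add_cons]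

lemma hmr_blk_diag (q : ℝ) (B : Finset (Fin n) → Matrix R C ℝ) (a b c : ℕ) :
    schattenPow q (hmrBlk (fun S => hmrDiag fun i => hmrB B i S) a b c) =
      schattenPow q (hmrBlk B a b (c + 1)) := by
  rw [← hmr_S_reindex q (hmrBlk B a b (c + 1)) (hmrEqC n a c R) (hmrEqC n b c C)]
  congr 1
  ext p s
  simp only [hmrBlk, hmr_coef_diag]
  simp only [of_apply, submatrix_apply, hmrDiag, hmrEqC, Equiv.coe_fn_mk,
    hmrMs_cons, Multiset.add_cons, Fin.cons_inj]
  by_cases h1 : p.2.1 = s.2.1 <;> by_cases h2 : p.2.2.1 = s.2.2.1 <;> simp [h1, h2]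

lemma hmr_P_vert (d : ℕ) (B : Finset (Fin n) → Matrix R C ℝ) (v : Fin n → ℝ) :
    (hmrVert fun i => hmrP d (hmrB B i) v) = hmrP d (fun S => hmrVert fun i => hmrB B i S) v := by
  ext p q
  simp [hmrVert, hmr_P_apply]

lemma hmr_P_horz (d : ℕ) (B : Finset (Fin n) → Matrix R C ℝ) (v : Fin n → ℝ) :
    (hmrHorz fun i => hmrP d (hmrB B i) v) = hmrP d (fun S => hmrHorz fun i => hmrB B i S) v := by
  ext p q
  simp [hmrHorz, hmr_P_apply]

lemma hmr_P_diag (d : ℕ) (B : Finset (Fin n) → Matrix R C ℝ) (v : Fin n → ℝ) :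
    (hmrDiag fun i => hmrP d (hmrB B i) v) = hmrP d (fun S => hmrDiag fun i => hmrB B i S) v := by
  ext p q
  by_cases h : p.1 = q.1 <;> simp [hmrDiag, hmr_P_apply, h]

lemma hmr_dil_add (A B : Matrix R C ℝ) (c : ℝ) : hmrDil (A + c • B) = hmrDil A + c • hmrDil B := by
  ext (a | a) (b | b) <;> simp [hmrDil]

lemma hmr_dil_smul (A : Matrix R C ℝ) (c : ℝ) : hmrDil (c • A) = c • hmrDil A := by
  ext (a | a) (b | b) <;> simp [hmrDil]

lemma hmr_dil_sum {ι : Type*} (s : Finset ι) (A : ι → Matrix R C ℝ) :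
    hmrDil (∑ i ∈ s, A i) = ∑ i ∈ s, hmrDil (A i) := by
  ext (a | a) (b | b) <;> simp [hmrDil, Matrix.sum_apply]

lemma hmr_dil_cont {Y : Type*} [TopologicalSpace Y] (A : Y → Matrix R C ℝ) (hA : Continuous A) :
    Continuous fun y => hmrDil (A y) := by
  unfold hmrDil
  exact continuous_const.matrix_fromBlocks hA hA.matrix_transpose continuous_const

lemma hmr_S_cont {Y : Type*} [TopologicalSpace Y] {q : ℝ} (hq : 0 < q) (A : Y → Matrix R C ℝ)
    (hA : Continuous A) : Continuous fun y => schattenPow q (A y) := by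
  have h := hmr_cont_tr' (fun s : ℝ => |s| ^ (2 * q)) (hmr_cont_abs (by linarith))
    (fun y => hmrDil (A y)) (hmr_dil_cont A hA) (fun y => hmrDil_herm _)
  simp only [hmr_S_dil hq.ne'] at h
  have h2 := h.const_mul (1 / 2)
  refine h2.congr fun y => ?_
  ring

lemma hmr_const {t L : ℝ} (ht : 2 ≤ t) (hL : 1 ≤ L) :
    (12 * (4 * t - 2 + 2)) ^ ((4 * t - 2 + 2) / 2) ≤ 2 / 3 * (48 * t) ^ (4 * t) ∧
    4 * (4 * t - 2 + 2) * (3 * (4 * t - 2) * L) ^ (4 * t - 2) ≤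
      1 / 3 * ((48 * t) ^ (4 * t) * L ^ (4 * t)) := by
  have e1 : 12 * (4 * t - 2 + 2) = 48 * t := by ring
  have e2 : (4 * t - 2 + 2) / 2 = 2 * t := by ring
  rw [e1, e2]
  have hp : (48 * t) ^ (4 * t) = (48 * t) ^ (2 * t) * (48 * t) ^ (2 * t) := by
    rw [← Real.rpow_add (by linarith)]; ring_nf
  have h1 : 48 * t ≤ (48 * t) ^ (2 * t) := by
    conv_lhs => rw [← Real.rpow_one (48 * t)]
    exact Real.rpow_le_rpow_of_exponent_le (by linarith) (by linarith)
  constructor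
  · rw [hp]; nlinarith
  · have h2 : (3 * (4 * t - 2) * L) ^ (4 * t - 2) ≤ (48 * t) ^ (4 * t - 2) * L ^ (4 * t) := by
      rw [Real.mul_rpow (by linarith) (by linarith)]
      refine mul_le_mul (Real.rpow_le_rpow (by linarith) (by linarith) (by linarith))
        (Real.rpow_le_rpow_of_exponent_le hL (by linarith)) (by positivity) (by positivity)
    have h3 : (48 * t) ^ (4 * t) = (48 * t) ^ (4 * t - 2) * (48 * t) ^ (2 : ℝ) := by
      rw [← Real.rpow_add (by linarith)]; ring_nf
    have h4 : (48 * t) ^ (2 : ℝ) = (48 * t) ^ 2 := Real.rpow_natCast _ 2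
    have h5 : 0 ≤ (48 * t) ^ (4 * t - 2) * L ^ (4 * t) := by positivity
    rw [h3, h4]
    calc _ ≤ 4 * (4 * t - 2 + 2) * ((48 * t) ^ (4 * t - 2) * L ^ (4 * t)) :=
          mul_le_mul_of_nonneg_left h2 (by linarith)
      _ = ((48 * t) ^ (4 * t - 2) * L ^ (4 * t)) * (16 * t) := by ring
      _ ≤ ((48 * t) ^ (4 * t - 2) * L ^ (4 * t)) * (1 / 3 * (48 * t) ^ 2) :=
          mul_le_mul_of_nonneg_left (by nlinarith) h5
      _ = _ := by ring

variable {Ω : Type*} [MeasurableSpace Ω] (μ : Measure Ω) [IsProbabilityMeasure μ]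

lemma hmr_one (x : Fin n → Ω → ℝ) (L : ℝ) (hL : 1 ≤ L) (hmeas : ∀ i, Measurable (x i))
    (hindep : iIndepFun x μ) (hmean : ∀ i, ∫ ω, x i ω ∂μ = 0)
    (hvar : ∀ i, ∫ ω, (x i ω) ^ 2 ∂μ = 1)
    (hbdd : ∀ i, ∀ᵐ ω ∂μ, |x i ω| ≤ L) {t : ℝ} (ht : 2 ≤ t) (d : ℕ)
    (B : Finset (Fin n) → Matrix R C ℝ) :
    ∫ ω, schattenPow (2 * t) (hmrP (d + 1) B fun i => x i ω) ∂μ ≤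
      (48 * t) ^ (4 * t) / 3 * (
        ∫ ω, schattenPow (2 * t) (hmrP d (fun S => hmrVert fun i => hmrB B i S) fun i => x i ω) ∂μ +
        ∫ ω, schattenPow (2 * t) (hmrP d (fun S => hmrHorz fun i => hmrB B i S) fun i => x i ω) ∂μ +
        L ^ (4 * t) *
        ∫ ω, schattenPow (2 * t) (hmrP d (fun S => hmrDiag fun i => hmrB B i S) fun i => x i ω) ∂μ) := by
  have hq : (2 * t) ≠ 0 := by linarith
  have hq0 : 0 < 2 * t := by linarith
  have I : ∀ φ : (Fin n → ℝ) → ℝ, Continuous φ → Integrable (fun ω => φ fun i => x i ω) μ :=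
    fun φ hφ => hmr_integrable μ x L hmeas hbdd φ hφ
  have key := hmr_step μ x L (by linarith) hmeas hindep hmean hvar hbdd (m := 4 * t - 2) (by linarith)
    (fun v => hmrDil (hmrP (d + 1) B v)) (fun i v => hmrDil (hmrP d (hmrB B i) v))
    (hmr_dil_cont _ (hmr_P_cont _ _)) (fun i => hmr_dil_cont _ (hmr_P_cont _ _))
    (fun v => hmrDil_herm _) (fun i v => hmrDil_herm _)
    (fun i v => by rw [← hmr_dil_add, ← hmr_X_split])
    (fun i v => by rw [hmr_D_indep]) (d + 1) (by omega)
    (fun v => by simp only [← hmr_dil_smul, ← hmr_dil_sum]; rw [hmr_euler])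
  obtain ⟨c1, c2⟩ := hmr_const ht hL
  have e1 : (4 * t - 2 + 2) = 2 * (2 * t) := by ring
  have e2 : 2 * (2 * t) / 2 = 2 * t := by ring
  rw [e1, e2] at key c1
  rw [e1] at c2
  simp only [hmr_S_dil hq, hmr_S_V hq, hmr_P_vert, hmr_P_horz] at key
  rw [integral_add (I _ (hmr_S_cont hq0 _ (hmr_P_cont _ _))) (I _ (hmr_S_cont hq0 _ (hmr_P_cont _ _)))]
    at key
  simp only [integral_const_mul, ← Finset.mul_sum] at key
  rw [← integral_finsetSum _ fun i _ => I _ (hmr_S_cont hq0 _ (hmr_P_cont _ _))] at key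
  simp only [← hmr_S_diag, hmr_P_diag] at key
  have n1 : 0 ≤ ∫ ω, schattenPow (2 * t)
      (hmrP d (fun S => hmrVert fun i => hmrB B i S) fun i => x i ω) ∂μ :=
    integral_nonneg fun ω => hmr_S_nonneg _ _
  have n2 : 0 ≤ ∫ ω, schattenPow (2 * t)
      (hmrP d (fun S => hmrHorz fun i => hmrB B i S) fun i => x i ω) ∂μ :=
    integral_nonneg fun ω => hmr_S_nonneg _ _
  have n3 : 0 ≤ ∫ ω, schattenPow (2 * t)
      (hmrP d (fun S => hmrDiag fun i => hmrB B i S) fun i => x i ω) ∂μ :=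
    integral_nonneg fun ω => hmr_S_nonneg _ _
  have m1 := mul_le_mul_of_nonneg_right c1 (add_nonneg n2 n1)
  have m2 := mul_le_mul_of_nonneg_right c2 n3
  linarith

def hmrT (d : ℕ) : Finset (ℕ × ℕ × ℕ) :=
  (Finset.range (d + 1) ×ˢ Finset.range (d + 1) ×ˢ Finset.range (d + 1)).filter
    fun p => p.1 + p.2.1 + p.2.2 = d

lemma hmrT_mem {d : ℕ} {p : ℕ × ℕ × ℕ} : p ∈ hmrT d ↔ p.1 + p.2.1 + p.2.2 = d := by
  simp only [hmrT, Finset.mem_filter, Finset.mem_product, Finset.mem_range]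
  omega

lemma hmrT_le {d : ℕ} (f g : ℕ × ℕ × ℕ → ℝ) (hf : ∀ p, 0 ≤ f p) (e : ℕ × ℕ × ℕ → ℕ × ℕ × ℕ)
    (he : Function.Injective e) (hd : ∀ p, (e p).1 + (e p).2.1 + (e p).2.2 = p.1 + p.2.1 + p.2.2 + 1)
    (hg : ∀ p, g p = f (e p)) :
    ∑ p ∈ hmrT d, g p ≤ ∑ p ∈ hmrT (d + 1), f p := by
  simp only [hg]
  rw [← Finset.sum_image (f := f) fun _ _ _ _ h => he h]
  refine Finset.sum_le_sum_of_subset_of_nonneg ?_ fun p _ _ => hf p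
  intro p hp
  obtain ⟨s, hs, rfl⟩ := Finset.mem_image.1 hp
  rw [hmrT_mem] at hs ⊢
  rw [hd, hs]

end recursion

lemma hmr_main {n : ℕ} {Ω : Type*} [MeasurableSpace Ω] (μ : Measure Ω) [IsProbabilityMeasure μ]
    (x : Fin n → Ω → ℝ) (L : ℝ) (hL : 1 ≤ L) (hmeas : ∀ i, Measurable (x i))
    (hindep : iIndepFun x μ) (hmean : ∀ i, ∫ ω, x i ω ∂μ = 0)
    (hvar : ∀ i, ∫ ω, (x i ω) ^ 2 ∂μ = 1)
    (hbdd : ∀ i, ∀ᵐ ω ∂μ, |x i ω| ≤ L) {t : ℝ} (ht : 2 ≤ t) (d : ℕ) :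
    ∀ {R : Type*} {C : Type*} [Fintype R] [Fintype C] [DecidableEq R] [DecidableEq C]
    (B : Finset (Fin n) → Matrix R C ℝ),
    ∫ ω, schattenPow (2 * t) (hmrP d B fun i => x i ω) ∂μ ≤
      ((48 * t) ^ (4 * t)) ^ d * ∑ p ∈ hmrT d, L ^ (4 * (p.2.2 : ℝ) * t) *
        schattenPow (2 * t) (hmrBlk B p.1 p.2.1 p.2.2) := by
  induction d with
  | zero =>
    intro R C _ _ _ _ B
    have h0 : ∀ v : Fin n → ℝ, hmrP 0 B v = B ∅ := by
      intro v; simp [hmrP]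
    have hT : hmrT 0 = {(0, 0, 0)} := by rfl
    simp only [h0, hT, Finset.sum_singleton, pow_zero, one_mul, Nat.cast_zero, mul_zero, zero_mul,
      Real.rpow_zero, integral_const, smul_eq_mul, probReal_univ]
    refine le_of_eq ?_
    rw [← hmr_S_reindex (2 * t) (B ∅) ((Equiv.uniqueProd _ _).trans (Equiv.uniqueProd R (Fin 0 → Fin n)) :
        (Fin 0 → Fin n) × (Fin 0 → Fin n) × R ≃ R)
      ((Equiv.uniqueProd _ _).trans (Equiv.uniqueProd C (Fin 0 → Fin n)) :
        (Fin 0 → Fin n) × (Fin 0 → Fin n) × C ≃ C)]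
    congr 1
  | succ d ih =>
    intro R C _ _ _ _ B
    refine (hmr_one μ x L hL hmeas hindep hmean hvar hbdd ht d B).trans ?_
    have i1 := ih (fun S => hmrVert fun i => hmrB B i S)
    have i2 := ih (fun S => hmrHorz fun i => hmrB B i S)
    have i3 := ih (fun S => hmrDiag fun i => hmrB B i S)
    simp only [hmr_blk_vert] at i1
    simp only [hmr_blk_horz] at i2
    simp only [hmr_blk_diag] at i3
    set K := (48 * t) ^ (4 * t) with hK
    have hK0 : 0 ≤ K := by positivity
    have hL0 : 0 ≤ L := by linarith
    set f : ℕ × ℕ × ℕ → ℝ := fun p => L ^ (4 * (p.2.2 : ℝ) * t) *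
        schattenPow (2 * t) (hmrBlk B p.1 p.2.1 p.2.2) with hf
    have hf0 : ∀ p, 0 ≤ f p := fun p => mul_nonneg (by positivity) (hmr_S_nonneg _ _)
    have j1 := hmrT_le (d := d) f (fun p => L ^ (4 * (p.2.2 : ℝ) * t) *
        schattenPow (2 * t) (hmrBlk B (p.1 + 1) p.2.1 p.2.2)) hf0 (fun p => (p.1 + 1, p.2.1, p.2.2))
        (by rintro ⟨a, b, c⟩ ⟨a', b', c'⟩ h; simpa using h) (by intro p; simp only; omega) (fun p => rfl)
    have j2 := hmrT_le (d := d) f (fun p => L ^ (4 * (p.2.2 : ℝ) * t) *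
        schattenPow (2 * t) (hmrBlk B p.1 (p.2.1 + 1) p.2.2)) hf0 (fun p => (p.1, p.2.1 + 1, p.2.2))
        (by rintro ⟨a, b, c⟩ ⟨a', b', c'⟩ h; simpa using h) (by intro p; simp only; omega) (fun p => rfl)
    have j3 := hmrT_le (d := d) f (fun p => L ^ (4 * t) * (L ^ (4 * (p.2.2 : ℝ) * t) *
        schattenPow (2 * t) (hmrBlk B p.1 p.2.1 (p.2.2 + 1)))) hf0 (fun p => (p.1, p.2.1, p.2.2 + 1))
        (by rintro ⟨a, b, c⟩ ⟨a', b', c'⟩ h; simpa using h) (by intro p; simp only; omega) (fun p => by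
          simp only [hf]
          rw [← mul_assoc, ← Real.rpow_add (by linarith)]
          congr 2
          push_cast; ring)
    rw [← Finset.mul_sum] at j3
    set F := ∑ p ∈ hmrT (d + 1), f p with hF
    have k1 := i1.trans (mul_le_mul_of_nonneg_left j1 (by positivity))
    have k2 := i2.trans (mul_le_mul_of_nonneg_left j2 (by positivity))
    have k3 := (mul_le_mul_of_nonneg_left i3 (show 0 ≤ L ^ (4 * t) by positivity)).trans
      ((le_of_eq (by ring)).trans (mul_le_mul_of_nonneg_left j3 (show 0 ≤ K ^ d by positivity)))
    calc _ ≤ K / 3 * (K ^ d * F + K ^ d * F + K ^ d * F) := by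
          refine mul_le_mul_of_nonneg_left ?_ (by positivity)
          exact add_le_add (add_le_add k1 k2) k3
      _ = _ := by ring

/-! ### final assembly -/

lemma hmr_F_eq {n d : ℕ} {R C : Type*} (A : (Fin d → Fin n) → Matrix R C ℝ) :
    (fun v : Fin n → ℝ => ∑ j ∈ Finset.univ.filter
        (fun j : Fin d → Fin n => Function.Injective j), (∏ m, v (j m)) • A j) =
      hmrP d (fun S => ∑ j ∈ (Finset.univ.filter
        (fun j : Fin d → Fin n => Function.Injective j)).filter
          (fun j => Finset.univ.image j = S), A j) := by
  ext1 v
  rw [hmrP, ← Finset.sum_fiberwise_of_maps_to (t := Finset.powersetCard d Finset.univ)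
    (g := fun j : Fin d → Fin n => Finset.univ.image j)]
  · refine Finset.sum_congr rfl fun S _ => ?_
    rw [Finset.smul_sum]
    refine Finset.sum_congr rfl fun j hj => ?_
    simp only [Finset.mem_filter, Finset.mem_univ, true_and] at hj
    rw [← hj.2, Finset.prod_image fun _ _ _ _ h => hj.1 h]
  · intro j hj
    simp only [Finset.mem_filter, Finset.mem_univ, true_and] at hj
    rw [Finset.mem_powersetCard]
    exact ⟨Finset.subset_univ _, by rw [Finset.card_image_of_injective _ hj]; simp⟩

lemma hmr_S_zero {R C : Type*} [Fintype R] [Fintype C] [DecidableEq R] [DecidableEq C] {q : ℝ}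
    (hq : q ≠ 0) : schattenPow q (0 : Matrix R C ℝ) = 0 := by
  rw [hmr_S_eq]
  simp [Matrix.charpoly_zero, Multiset.map_nsmul, Multiset.sum_nsmul, Real.zero_rpow hq]

lemma hmr_mean {n : ℕ} {Ω : Type*} [MeasurableSpace Ω] (μ : Measure Ω) [IsProbabilityMeasure μ]
    (x : Fin n → Ω → ℝ) (L : ℝ) (hmeas : ∀ i, Measurable (x i))
    (hindep : iIndepFun x μ) (hmean : ∀ i, ∫ ω, x i ω ∂μ = 0)
    (hbdd : ∀ i, ∀ᵐ ω ∂μ, |x i ω| ≤ L) (d : ℕ) {R C : Type*}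
    (B : Finset (Fin n) → Matrix R C ℝ) :
    matIntegral μ (fun ω => hmrP (d + 1) B fun i => x i ω) = 0 := by
  ext r c
  simp only [matIntegral, of_apply, Matrix.zero_apply]
  have I : ∀ φ : (Fin n → ℝ) → ℝ, Continuous φ → Integrable (fun ω => φ fun i => x i ω) μ :=
    fun φ hφ => hmr_integrable μ x L hmeas hbdd φ hφ
  have cont : ∀ i, Continuous fun v => hmrP d (hmrB B i) v r c := fun i =>
    (hmr_P_cont d (hmrB B i)).matrix_elem r c
  have h : ∀ ω, ((d + 1 : ℕ) : ℝ) * hmrP (d + 1) B (fun i => x i ω) r c =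
      ∑ i, x i ω * hmrP d (hmrB B i) (fun i => x i ω) r c := by
    intro ω
    have := congrFun (congrFun (hmr_euler d B fun i => x i ω) r) c
    simpa [Matrix.sum_apply] using this.symm
  have h2 : ((d + 1 : ℕ) : ℝ) * ∫ ω, hmrP (d + 1) B (fun i => x i ω) r c ∂μ = 0 := by
    rw [← integral_const_mul]
    simp only [h]
    rw [integral_finsetSum _ fun i _ => I (fun v => v i * hmrP d (hmrB B i) v r c)
      ((continuous_apply i).mul (cont i))]
    refine Finset.sum_eq_zero fun i _ => ?_
    have := hmr_indep μ x hmeas hindep i (fun s => s) continuous_id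
      (fun v => hmrP d (hmrB B i) v r c) (cont i) (fun v => by simp only [hmr_D_indep])
    rw [this, hmean, zero_mul]
  rcases mul_eq_zero.1 h2 with h3 | h3
  · exact absurd h3 (by positivity)
  · exact h3

lemma hmr_L_ge {n : ℕ} {Ω : Type*} [MeasurableSpace Ω] (μ : Measure Ω) [IsProbabilityMeasure μ]
    (x : Fin n → Ω → ℝ) (L : ℝ) (hmeas : ∀ i, Measurable (x i))
    (hvar : ∀ i, ∫ ω, (x i ω) ^ 2 ∂μ = 1)
    (hbdd : ∀ i, ∀ᵐ ω ∂μ, |x i ω| ≤ L) (i : Fin n) : 1 ≤ L := by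
  obtain ⟨ω, hω⟩ := (hbdd i).exists
  have hL0 : 0 ≤ L := (abs_nonneg _).trans hω
  have h : ∫ ω, (x i ω) ^ 2 ∂μ ≤ ∫ _ω, L ^ 2 ∂μ := by
    refine integral_mono_ae (hmr_integrable μ x L hmeas hbdd (fun v => v i ^ 2) (by fun_prop))
      (integrable_const _) ?_
    filter_upwards [hbdd i] with ω hω
    rw [← sq_abs]
    exact pow_le_pow_left₀ (abs_nonneg _) hω 2
  rw [hvar] at h
  simp at h
  rwa [abs_of_nonneg hL0] at h


/-- **Homogeneous multilinear recursion** (Theorem 4.5 / Theorem 1.1). Let `x 1, …, x n` be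
i.i.d. real random variables with mean `0`, variance `1` and `|x i| ≤ L` a.s., and let
`{A j}_{j ∈ T^d_n}` be permutation-symmetric deterministic matrices of a common dimension.
For the degree-`d` homogeneous multilinear polynomial random matrix
`F(x) = ∑_{j ∈ T^d_n} (∏_m x_{j m}) • A j` and every `2 ≤ t < ∞`,
`E ‖F(x) − E F(x)‖_{4t}^{4t} ≤ ∑_{a+b+c=d} (48dt)^{4dt} L^{4ct} ‖F_{a,b,c}‖_{4t}^{4t}`,
the matrices `F_{a,b,c}` with `a+b+c = d` being deterministic. -/
theorem homogeneous_multilinear_recursion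
    {Ω : Type*} [MeasurableSpace Ω] (μ : Measure Ω) [IsProbabilityMeasure μ]
    (n d : ℕ) {d₁ d₂ : Type*} [Fintype d₁] [Fintype d₂] [DecidableEq d₁] [DecidableEq d₂]
    (x : Fin n → Ω → ℝ) (L : ℝ)
    (hmeas : ∀ i, Measurable (x i))
    (hindep : iIndepFun x μ)
    (hid : ∀ i j, IdentDistrib (x i) (x j) μ μ)
    (hmean : ∀ i, ∫ ω, x i ω ∂μ = 0)
    (hvar : ∀ i, ∫ ω, (x i ω) ^ 2 ∂μ = 1)
    (hbdd : ∀ i, ∀ᵐ ω ∂μ, |x i ω| ≤ L)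
    (A : (Fin d → Fin n) → Matrix d₁ d₂ ℝ)
    (hsymm : ∀ (σ : Equiv.Perm (Fin d)) (j : Fin d → Fin n), A (j ∘ σ) = A j)
    (F : (Fin n → ℝ) → Matrix d₁ d₂ ℝ)
    (hF : F = fun v => ∑ j ∈ Finset.univ.filter
        (fun j : Fin d → Fin n => Function.Injective j),
      (∏ m, v (j m)) • A j)
    (t : ℝ) (ht : 2 ≤ t) :
    ∫ ω, schattenPow (2 * t)
        ((F fun i => x i ω) - matIntegral μ fun ω => F fun i => x i ω) ∂μ
      ≤ ∑ a ∈ Finset.range (d + 1), ∑ b ∈ Finset.range (d + 1), ∑ c ∈ Finset.range (d + 1),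
          if a + b + c = d then
            (48 * d * t) ^ (4 * d * t) * L ^ (4 * c * t) *
              schattenPow (2 * t) (derivBlocks F a b c 0)
          else 0 := by
  have hq : (2 * t) ≠ 0 := by linarith
  rw [hmr_F_eq] at hF
  have rhs : ∀ B : Finset (Fin n) → Matrix d₁ d₂ ℝ, F = hmrP d B →
      (∑ a ∈ Finset.range (d + 1), ∑ b ∈ Finset.range (d + 1), ∑ c ∈ Finset.range (d + 1),
          if a + b + c = d then
            (48 * d * t) ^ (4 * d * t) * L ^ (4 * c * t) *
              schattenPow (2 * t) (derivBlocks F a b c 0)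
          else 0) = ∑ p ∈ hmrT d, (48 * d * t) ^ (4 * d * t) * L ^ (4 * (p.2.2 : ℝ) * t) *
              schattenPow (2 * t) (hmrBlk B p.1 p.2.1 p.2.2) := by
    intro B hB
    rw [hmrT, Finset.sum_filter, Finset.sum_product]
    simp only [Finset.sum_product]
    refine Finset.sum_congr rfl fun a _ => Finset.sum_congr rfl fun b _ =>
      Finset.sum_congr rfl fun c _ => ?_
    split_ifs with h
    · rw [hB, hmr_derivBlocks B h]
    · rfl
  rcases Nat.eq_zero_or_pos d with hd | hd
  · subst hd
    rw [rhs _ hF]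
    have hz : ∀ v, F v = F 0 := by
      intro v
      rw [hF]
      simp [hmrP]
    have hm : matIntegral μ (fun ω => F fun i => x i ω) = F 0 := by
      ext r c
      simp only [matIntegral, of_apply, hz fun i => x i _]
      simp
    have hl : ∀ ω, (F fun i => x i ω) - matIntegral μ (fun ω => F fun i => x i ω) = 0 := by
      intro ω
      rw [hm, hz fun i => x i ω, sub_self]
    simp only [hl, hmr_S_zero hq, integral_zero]
    refine Finset.sum_nonneg fun p hp => ?_
    have hp' := hmrT_mem.1 hp
    have hc : p.2.2 = 0 := by omega
    refine mul_nonneg ?_ (hmr_S_nonneg _ _)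
    simp [hc]
  · obtain ⟨d, rfl⟩ : ∃ e, d = e + 1 := ⟨d - 1, by omega⟩
    rcases Nat.eq_zero_or_pos n with hn | hn
    · subst hn
      have hF0 : F = hmrP (d + 1) (fun _ => (0 : Matrix d₁ d₂ ℝ)) := by
        rw [hF]
        ext1 v
        simp [hmrP]
      rw [rhs _ hF0]
      have hb : ∀ p : ℕ × ℕ × ℕ,
          hmrBlk (fun _ : Finset (Fin 0) => (0 : Matrix d₁ d₂ ℝ)) p.1 p.2.1 p.2.2 = 0 := by
        intro p
        ext r c
        simp [hmrBlk, hmrCoef]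
      have hv : ∀ v, F v = 0 := by
        intro v
        rw [hF0]
        simp [hmrP]
      have hm : matIntegral μ (fun ω => F fun i => x i ω) = 0 := by
        ext r c
        simp [matIntegral, hv]
      rw [hm]
      simp only [hb, hv, sub_zero, hmr_S_zero hq, mul_zero, Finset.sum_const_zero, integral_zero]
      exact le_refl _
    · have hL : 1 ≤ L := hmr_L_ge μ x L hmeas hvar hbdd ⟨0, hn⟩
      rw [rhs _ hF]
      have hm := hmr_mean μ x L hmeas hindep hmean hbdd d
        (fun S => ∑ j ∈ (Finset.univ.filter
        (fun j : Fin (d + 1) → Fin n => Function.Injective j)).filter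
          (fun j => Finset.univ.image j = S), A j)
      rw [← hF] at hm
      rw [hm]
      simp only [sub_zero]
      have main := hmr_main μ x L hL hmeas hindep hmean hvar hbdd ht (d + 1)
        (fun S => ∑ j ∈ (Finset.univ.filter
        (fun j : Fin (d + 1) → Fin n => Function.Injective j)).filter
          (fun j => Finset.univ.image j = S), A j)
      rw [← hF] at main
      refine main.trans ?_
      rw [Finset.mul_sum]
      have hd1 : (1 : ℝ) ≤ ((d + 1 : ℕ) : ℝ) := by exact_mod_cast hd
      have hK : ((48 * t) ^ (4 * t)) ^ (d + 1) ≤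
          (48 * ((d + 1 : ℕ) : ℝ) * t) ^ (4 * ((d + 1 : ℕ) : ℝ) * t) := by
        rw [← Real.rpow_natCast, ← Real.rpow_mul (by linarith)]
        have e : 4 * t * ((d + 1 : ℕ) : ℝ) = 4 * ((d + 1 : ℕ) : ℝ) * t := by ring
        rw [e]
        refine Real.rpow_le_rpow (by linarith) ?_ (by positivity)
        nlinarith
      refine Finset.sum_le_sum fun p _ => ?_
      rw [← mul_assoc]
      have hL0 : 0 ≤ L := by linarith
      exact mul_le_mul_of_nonneg_right (mul_le_mul_of_nonneg_right hK (by positivity))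
        (hmr_S_nonneg _ _)
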